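/- arXiv:2010.09841 — 2 statements merged into one kernel-verified Lean document; each statement's English description precedes it below -/
import Mathlib

section
/- Let $R = \mathbb{C}[x,y]$ and let $I \subset R$ be a monomial ideal with $\dim_{\mathbb{C}} R/I = n$. Then $\dim_{\mathbb{C}} \operatorname{Hom}_R(I, R/I) = 2n$. -/
open MvPolynomial

/-- A monomial ideal is an ideal generated by monomials. -/
def IsMonomialIdeal (I : Ideal (MvPolynomial (Fin 2) ℂ)) : Prop :=
  ∃ S : Set (Fin 2 →₀ ℕ), I = Ideal.span ((fun s => (monomial s (1 : ℂ) : MvPolynomial (Fin 2) ℂ)) '' S)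

/-- A linear map out of a quotient of `ℂ[x,y]` is determined by its values on monomials. -/
theorem quotient_linearMap_ext {I : Ideal (MvPolynomial (Fin 2) ℂ)} {M : Type*}
    [AddCommGroup M] [Module ℂ M] {f g : (MvPolynomial (Fin 2) ℂ ⧸ I) →ₗ[ℂ] M}
    (H : ∀ i j, f (Ideal.Quotient.mk I (X 0) ^ i * Ideal.Quotient.mk I (X 1) ^ j) =
      g (Ideal.Quotient.mk I (X 0) ^ i * Ideal.Quotient.mk I (X 1) ^ j)) : f = g := by
  have key : f ∘ₗ (Ideal.Quotient.mkₐ ℂ I).toLinearMap =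
      g ∘ₗ (Ideal.Quotient.mkₐ ℂ I).toLinearMap := by
    refine (basisMonomials (Fin 2) ℂ).ext fun s => ?_
    have := H (s 0) (s 1)
    simpa [monomial_eq, Finsupp.prod_fintype] using this
  ext v
  obtain ⟨r, rfl⟩ := Ideal.Quotient.mk_surjective v
  exact LinearMap.congr_fun key r

/-- The exponents of the monomials in `I` are the points on or above the graph of `h`. -/
structure IsStaircase (I : Ideal (MvPolynomial (Fin 2) ℂ)) (h : ℕ → ℕ) : Prop where
  antitone : Antitone h
  mem_iff : ∀ f, f ∈ I ↔ ∀ s ∈ f.support, h (s 0) ≤ s 1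

namespace IsStaircase

variable {I : Ideal (MvPolynomial (Fin 2) ℂ)} {h : ℕ → ℕ}

theorem X_pow_mem (hI : IsStaircase I h) {i j : ℕ} (hij : h i ≤ j) :
    (X 0 ^ i * X 1 ^ j : MvPolynomial (Fin 2) ℂ) ∈ I := by
  have : (X 0 ^ i * X 1 ^ j : MvPolynomial (Fin 2) ℂ) =
      monomial (Finsupp.single 0 i + Finsupp.single 1 j) 1 := by
    simp [monomial_eq, Finsupp.prod_fintype]
  rw [this, hI.mem_iff]
  intro s hs
  have := support_monomial_subset hs
  simp only [Finset.mem_singleton] at this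
  subst this
  simpa using hij

theorem mk_X_pow_eq_zero (hI : IsStaircase I h) {i j : ℕ} (hij : h i ≤ j) :
    Ideal.Quotient.mk I (X 0) ^ i * Ideal.Quotient.mk I (X 1) ^ j = 0 := by
  simpa using Ideal.Quotient.eq_zero_iff_mem.mpr (hI.X_pow_mem hij)

theorem map_eq_zero (hI : IsStaircase I h) {M : Type*} [AddCommGroup M] [Module ℂ M]
    (F : MvPolynomial (Fin 2) ℂ →ₗ[ℂ] M)
    (hF : ∀ s : Fin 2 →₀ ℕ, h (s 0) ≤ s 1 → F (monomial s 1) = 0) {f : MvPolynomial (Fin 2) ℂ}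
    (hf : f ∈ I) : F f = 0 := by
  rw [f.as_sum, map_sum]
  refine Finset.sum_eq_zero fun s hs => ?_
  have : (monomial s (coeff s f) : MvPolynomial (Fin 2) ℂ) = coeff s f • monomial s 1 := by
    simp [smul_monomial]
  rw [this, map_smul, hF s ((hI.mem_iff f).mp hf s hs), smul_zero]

theorem finite_quotient (hI : IsStaircase I h) {a : ℕ} (ha : h a = 0) :
    Module.Finite ℂ (MvPolynomial (Fin 2) ℂ ⧸ I) := by
  set x := Ideal.Quotient.mk I (X 0)
  set y := Ideal.Quotient.mk I (X 1)
  set W := Submodule.span ℂ (Set.range fun p : Fin a × Fin (h 0) => x ^ (p.1 : ℕ) * y ^ (p.2 : ℕ))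
  have hW : W.mkQ = 0 := by
    refine quotient_linearMap_ext fun i j => ?_
    rw [LinearMap.zero_apply, Submodule.mkQ_apply, Submodule.Quotient.mk_eq_zero]
    by_cases hij : h i ≤ j
    · rw [hI.mk_X_pow_eq_zero hij]
      exact W.zero_mem
    · have hi : i < a := by
        by_contra! hia
        have := hI.antitone hia
        omega
      have hj : j < h 0 := lt_of_lt_of_le (not_le.mp hij) (hI.antitone (Nat.zero_le i))
      exact Submodule.subset_span ⟨(⟨i, hi⟩, ⟨j, hj⟩), rfl⟩
  have hW' : W = ⊤ := by
    rw [← W.ker_mkQ, hW, LinearMap.ker_zero]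
  exact ⟨hW' ▸ Submodule.fg_span (Set.finite_range _)⟩

/-- The functional on `ℂ[x,y] ⧸ I` with prescribed values on the monomials outside `I`. -/
theorem exists_functional (hI : IsStaircase I h) (c : ℕ → ℕ → ℂ) (hc : ∀ i j, h i ≤ j → c i j = 0) :
    ∃ ψ : Module.Dual ℂ (MvPolynomial (Fin 2) ℂ ⧸ I), ∀ i j,
      ψ (Ideal.Quotient.mk I (X 0) ^ i * Ideal.Quotient.mk I (X 1) ^ j) = c i j := by
  let F : MvPolynomial (Fin 2) ℂ →ₗ[ℂ] ℂ :=
    (basisMonomials (Fin 2) ℂ).constr ℂ fun s => c (s 0) (s 1)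
  have hF (s : Fin 2 →₀ ℕ) : F (monomial s 1) = c (s 0) (s 1) := by
    have := (basisMonomials (Fin 2) ℂ).constr_basis ℂ (fun s => c (s 0) (s 1)) s
    simpa using this
  let G : (MvPolynomial (Fin 2) ℂ ⧸ I.restrictScalars ℂ) →ₗ[ℂ] ℂ :=
    (I.restrictScalars ℂ).liftQ F fun f hf =>
      hI.map_eq_zero F (fun s hs => (hF s).trans (hc _ _ hs)) hf
  refine ⟨G ∘ₗ (Submodule.Quotient.restrictScalarsEquiv ℂ I).symm.toLinearMap, fun i j => ?_⟩
  have := hF (Finsupp.single 0 i + Finsupp.single 1 j)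
  rw [show (monomial (Finsupp.single 0 i + Finsupp.single 1 j) 1 : MvPolynomial (Fin 2) ℂ)
    = X 0 ^ i * X 1 ^ j by simp [monomial_eq, Finsupp.prod_fintype]] at this
  simp only [Finsupp.add_apply, Finsupp.single_apply] at this
  replace this : F (X 0 ^ i * X 1 ^ j) = c i j := by simpa using this
  rw [← map_pow, ← map_pow, ← map_mul]
  exact this

/-- A functional on `ℂ[x,y] ⧸ I` induces, by shifting along the staircase, a compatible sequence of
functionals. -/
theorem exists_shift (hI : IsStaircase I h) :
    ∃ T : Module.Dual ℂ (MvPolynomial (Fin 2) ℂ ⧸ I) →ₗ[ℂ]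
        (ℕ → Module.Dual ℂ (MvPolynomial (Fin 2) ℂ ⧸ I)),
      ∀ ψ i p q, T ψ i (Ideal.Quotient.mk I (X 0) ^ p * Ideal.Quotient.mk I (X 1) ^ q) =
        if p ≤ i then ψ (Ideal.Quotient.mk I (X 0) ^ (i - p) *
          Ideal.Quotient.mk I (X 1) ^ (q + (h (i - p) - h i))) else 0 := by
  have key (ψ : Module.Dual ℂ (MvPolynomial (Fin 2) ℂ ⧸ I)) (i : ℕ) :=
    hI.exists_functional (fun p q => if p ≤ i then ψ (Ideal.Quotient.mk I (X 0) ^ (i - p) *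
      Ideal.Quotient.mk I (X 1) ^ (q + (h (i - p) - h i))) else 0) (by
        intro p q hpq
        split_ifs with hpi
        · rw [hI.mk_X_pow_eq_zero, map_zero]
          have := hI.antitone hpi
          omega
        · rfl)
  choose T hT using key
  refine ⟨{ toFun := T, map_add' := fun ψ ψ' => ?_, map_smul' := fun r ψ => ?_ }, hT⟩
  · funext i
    refine quotient_linearMap_ext fun p q => ?_
    rw [Pi.add_apply, LinearMap.add_apply, hT ψ, hT ψ', hT]
    split_ifs <;> simp
  · funext i
    refine quotient_linearMap_ext fun p q => ?_
    rw [Pi.smul_apply, LinearMap.smul_apply, hT ψ, hT]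
    split_ifs <;> simp

end IsStaircase

/-- The transpose of the matrix of syzygies between the generators `x ^ i * y ^ h i`. -/
noncomputable def syzygyMap {B : Type*} [CommRing B] [Algebra ℂ B] (x y : B) (h : ℕ → ℕ) (a : ℕ) :
    (Fin (a + 1) → B) →ₗ[ℂ] (Fin a → B) :=
  LinearMap.pi fun i => LinearMap.mulLeft ℂ x ∘ₗ LinearMap.proj i.castSucc -
    LinearMap.mulLeft ℂ (y ^ (h i - h (i + 1))) ∘ₗ LinearMap.proj i.succ

theorem syzygyMap_apply {B : Type*} [CommRing B] [Algebra ℂ B] (x y : B) (h : ℕ → ℕ) (a : ℕ)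
    (u : Fin (a + 1) → B) (i : Fin a) : syzygyMap x y h a u i =
      x * u i.castSucc - y ^ (h i - h (i + 1)) * u i.succ := rfl

/-- The components of a functional vanishing on the range of `syzygyMap`, extended by zero, satisfy
recursive relations. -/
theorem syzygyMap_dual_relations {B : Type*} [CommRing B] [Algebra ℂ B] {x y : B} {h : ℕ → ℕ}
    {a : ℕ} {Ψ : Module.Dual ℂ (Fin a → B)} (hΨ : Ψ ∘ₗ syzygyMap x y h a = 0) :
    ∃ Ψ' : ℕ → Module.Dual ℂ B, (∀ u, Ψ u = ∑ i : Fin a, Ψ' i (u i)) ∧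
      (∀ i, a ≤ i → Ψ' i = 0) ∧ (∀ v, Ψ' 0 (x * v) = 0) ∧
      ∀ i v, Ψ' (i + 1) (x * v) = Ψ' i (y ^ (h i - h (i + 1)) * v) := by
  classical
  set Ψ' : ℕ → Module.Dual ℂ B := fun i =>
    if hi : i < a then Ψ ∘ₗ LinearMap.single ℂ (fun _ => B) ⟨i, hi⟩ else 0 with hΨ'
  have hsum (u : Fin a → B) : Ψ u = ∑ i : Fin a, Ψ' i (u i) := by
    conv_lhs => rw [← Finset.univ_sum_single u, map_sum]
    simp [hΨ']
  have hrel (j : Fin (a + 1)) (v : B) :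
      ∑ i : Fin a, Ψ' i (x * (if i.castSucc = j then v else 0)) =
      ∑ i : Fin a, Ψ' i (y ^ (h i - h (i + 1)) * (if i.succ = j then v else 0)) := by
    have := LinearMap.congr_fun hΨ (fun k => if k = j then v else 0)
    rw [LinearMap.comp_apply, hsum] at this
    simpa [syzygyMap_apply, sub_eq_zero] using this
  refine ⟨Ψ', hsum, fun i hi => by simp [hΨ', not_lt.mpr hi], fun v => ?_, fun i v => ?_⟩
  · rcases Nat.eq_zero_or_pos a with rfl | ha
    · simp [hΨ']
    · have := hrel 0 v
      obtain ⟨b, rfl⟩ := Nat.exists_eq_succ_of_ne_zero ha.ne'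
      simpa [mul_ite, apply_ite] using this
  · by_cases hi : i < a
    · have := hrel (Fin.succ ⟨i, hi⟩) v
      simp only [Fin.succ_inj, mul_ite, mul_zero, apply_ite (Ψ' _), map_zero, Finset.sum_ite_eq',
        Finset.mem_univ, if_true] at this
      rw [← this]
      by_cases hi' : i + 1 < a
      · rw [Finset.sum_eq_single ⟨i + 1, hi'⟩]
        · simp
        · intro j _ hj
          rw [if_neg]
          simpa [Fin.ext_iff] using hj
        · simp
      · rw [Finset.sum_eq_zero]
        · simp [hΨ', hi']
        · intro j _
          rw [if_neg]
          simp only [Fin.ext_iff, Fin.val_castSucc, Fin.val_succ]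
          omega
    · simp [hΨ', hi, show ¬ i + 1 < a by omega]

theorem dual_eq_zero_of_le {B : Type*} [CommRing B] [Algebra ℂ B] {x y : B} {h : ℕ → ℕ}
    (hh : Antitone h) {a : ℕ} {Ψ : ℕ → Module.Dual ℂ B} (h0 : ∀ i, a ≤ i → Ψ i = 0)
    (hrel : ∀ i v, Ψ (i + 1) (x * v) = Ψ i (y ^ (h i - h (i + 1)) * v)) (i : ℕ) :
    ∀ v, Ψ i (y ^ h i * v) = 0 := by
  rcases le_total a i with hi | hi
  · simp [h0 i hi]
  · induction hi using Nat.decreasingInduction with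
    | self => simp [h0 a le_rfl]
    | of_succ k hk ih =>
      intro v
      have := hrel k (y ^ h (k + 1) * v)
      rw [← mul_assoc, ← mul_assoc, ← pow_add, Nat.sub_add_cancel (hh (Nat.le_succ k)),
        mul_comm x, mul_assoc, ih] at this
      exact this.symm

theorem dual_eq_zero {I : Ideal (MvPolynomial (Fin 2) ℂ)} {h : ℕ → ℕ}
    {Ψ : ℕ → Module.Dual ℂ (MvPolynomial (Fin 2) ℂ ⧸ I)}
    (h0 : ∀ v, Ψ 0 (Ideal.Quotient.mk I (X 0) * v) = 0)
    (hrel : ∀ i v, Ψ (i + 1) (Ideal.Quotient.mk I (X 0) * v) =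
      Ψ i (Ideal.Quotient.mk I (X 1) ^ (h i - h (i + 1)) * v))
    (hΨ : ∀ i q, Ψ i (Ideal.Quotient.mk I (X 1) ^ q) = 0) (i : ℕ) : Ψ i = 0 := by
  refine quotient_linearMap_ext fun p q => ?_
  rw [LinearMap.zero_apply]
  induction p generalizing i q with
  | zero => simpa using hΨ i q
  | succ p ih =>
    rw [pow_succ', mul_assoc]
    cases i with
    | zero => exact h0 _
    | succ i =>
      rw [hrel, mul_left_comm, ← pow_add]
      exact ih i _

namespace IsStaircase

variable {I : Ideal (MvPolynomial (Fin 2) ℂ)} {h : ℕ → ℕ}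

/-- The cokernel of the transposed syzygy matrix is dual to the quotient ring. -/
theorem finrank_ker_dualMap (hI : IsStaircase I h) {a : ℕ} (ha : h a = 0) :
    Module.finrank ℂ (syzygyMap (Ideal.Quotient.mk I (X 0))
      (Ideal.Quotient.mk I (X 1)) h a).dualMap.ker =
    Module.finrank ℂ (MvPolynomial (Fin 2) ℂ ⧸ I) := by
  have := hI.finite_quotient ha
  rw [← Subspace.dual_finrank_eq (V := MvPolynomial (Fin 2) ℂ ⧸ I)]
  set x := Ideal.Quotient.mk I (X 0)
  set y := Ideal.Quotient.mk I (X 1)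
  apply le_antisymm
  · have key (Ψ : (syzygyMap x y h a).dualMap.ker) :
        ∃ ψ : Module.Dual ℂ (MvPolynomial (Fin 2) ℂ ⧸ I), ∀ i q,
          ψ (x ^ i * y ^ q) = if hi : i < a then Ψ.1 (Pi.single ⟨i, hi⟩ (y ^ q)) else 0 := by
      obtain ⟨Ψ, hΨ⟩ := Ψ
      obtain ⟨Ψ', hsum, h0, hx0, hrel⟩ := syzygyMap_dual_relations (Ψ := Ψ) (LinearMap.mem_ker.mp hΨ)
      refine hI.exists_functional _ fun i q hiq => ?_
      split_ifs with hi
      · have hq := dual_eq_zero_of_le hI.antitone h0 hrel i (y ^ (q - h i))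
        rw [← pow_add, Nat.add_sub_cancel' hiq] at hq
        simp only [hsum]
        refine Finset.sum_eq_zero fun j _ => ?_
        rcases eq_or_ne j ⟨i, hi⟩ with rfl | hj
        · simpa using hq
        · simp [Pi.single_eq_of_ne hj]
      · rfl
    choose K hK using key
    let K' : (syzygyMap x y h a).dualMap.ker →ₗ[ℂ] Module.Dual ℂ (MvPolynomial (Fin 2) ℂ ⧸ I) :=
      { toFun := K
        map_add' := fun Ψ Ψ' => quotient_linearMap_ext fun i q => by
          rw [LinearMap.add_apply, hK, hK, hK]
          split_ifs <;> simp
        map_smul' := fun r Ψ => quotient_linearMap_ext fun i q => by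
          rw [LinearMap.smul_apply, hK, hK]
          split_ifs <;> simp }
    refine LinearMap.finrank_le_finrank_of_injective (f := K')
      ((injective_iff_map_eq_zero K').mpr ?_)
    rintro ⟨Ψ, hΨ⟩ hzero
    obtain ⟨Ψ', hsum, h0, hx0, hrel⟩ := syzygyMap_dual_relations (Ψ := Ψ) (LinearMap.mem_ker.mp hΨ)
    have hval (i : ℕ) (q : ℕ) : Ψ' i (y ^ q) = 0 := by
      by_cases hi : i < a
      · have := hK ⟨Ψ, hΨ⟩ i q
        rw [show K ⟨Ψ, hΨ⟩ = 0 from hzero, dif_pos hi, hsum, Finset.sum_eq_single ⟨i, hi⟩] at this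
        · simpa using this.symm
        · intro j _ hj
          simp [Pi.single_eq_of_ne hj]
        · simp
      · simp [h0 i (not_lt.mp hi)]
    ext1
    refine LinearMap.ext fun u => ?_
    simp [hsum, dual_eq_zero hx0 hrel hval]
  · obtain ⟨T, hT⟩ := hI.exists_shift
    have hT0 (ψ) (v) : T ψ 0 (x * v) = 0 := by
      suffices T ψ 0 ∘ₗ LinearMap.mulLeft ℂ x = 0 from LinearMap.congr_fun this v
      refine quotient_linearMap_ext fun p q => ?_
      rw [LinearMap.comp_apply, LinearMap.mulLeft_apply, ← mul_assoc, ← pow_succ', hT]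
      simp
    have hTa (ψ) : T ψ a = 0 := by
      refine quotient_linearMap_ext fun p q => ?_
      rw [hT]
      split_ifs with hp
      · rw [hI.mk_X_pow_eq_zero (by omega), map_zero, LinearMap.zero_apply]
      · rfl
    have hTs (ψ) (i) (v) : T ψ (i + 1) (x * v) = T ψ i (y ^ (h i - h (i + 1)) * v) := by
      suffices T ψ (i + 1) ∘ₗ LinearMap.mulLeft ℂ x =
        T ψ i ∘ₗ LinearMap.mulLeft ℂ (y ^ (h i - h (i + 1))) from LinearMap.congr_fun this v
      refine quotient_linearMap_ext fun p q => ?_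
      rw [LinearMap.comp_apply, LinearMap.comp_apply, LinearMap.mulLeft_apply,
        LinearMap.mulLeft_apply, ← mul_assoc, ← pow_succ', hT, mul_left_comm, ← pow_add, hT]
      by_cases hp : p ≤ i
      · have h1 := hI.antitone (Nat.sub_le i p)
        have h2 := hI.antitone (Nat.le_succ i)
        rw [if_pos (by omega), if_pos hp, Nat.add_sub_add_right]
        congr 3
        simp only [Nat.succ_eq_add_one] at h2
        omega
      · rw [if_neg (by omega), if_neg hp]
    let L : Module.Dual ℂ (MvPolynomial (Fin 2) ℂ ⧸ I) →ₗ[ℂ]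
        Module.Dual ℂ (Fin a → MvPolynomial (Fin 2) ℂ ⧸ I) :=
      { toFun := fun ψ => ∑ i : Fin a, T ψ i ∘ₗ LinearMap.proj i
        map_add' := fun ψ ψ' => by
          refine LinearMap.ext fun u => ?_
          simp [Finset.sum_add_distrib]
        map_smul' := fun r ψ => by
          refine LinearMap.ext fun u => ?_
          simp [Finset.mul_sum] }
    have hL (ψ) (u) : L ψ u = ∑ i : Fin a, T ψ i (u i) := by simp [L]
    have hmem (ψ) : L ψ ∈ (syzygyMap x y h a).dualMap.ker := by
      refine LinearMap.mem_ker.mpr (LinearMap.ext fun u => ?_)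
      rw [LinearMap.dualMap_apply, hL, LinearMap.zero_apply]
      simp only [syzygyMap_apply, map_sub, Finset.sum_sub_distrib, ← hTs]
      have h1 := Fin.sum_univ_castSucc fun j : Fin (a + 1) => T ψ j (x * u j)
      have h2 := Fin.sum_univ_succ fun j : Fin (a + 1) => T ψ j (x * u j)
      simp only [Fin.val_castSucc, Fin.val_last, hTa, Fin.val_succ, Fin.val_zero, hT0,
        LinearMap.zero_apply, add_zero, zero_add] at h1 h2
      rw [← h1, ← h2, sub_self]
    refine LinearMap.finrank_le_finrank_of_injective (f := L.codRestrict _ hmem)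
      ((injective_iff_map_eq_zero _).mpr fun ψ hψ => ?_)
    have hψ' : L ψ = 0 := congrArg Subtype.val hψ
    refine quotient_linearMap_ext fun i q => ?_
    by_cases hi : i < a
    · have h1 := LinearMap.congr_fun hψ' (Pi.single ⟨i, hi⟩ (x ^ 0 * y ^ q))
      rw [hL, Finset.sum_eq_single ⟨i, hi⟩] at h1
      · rw [Pi.single_eq_same, hT] at h1
        simpa using h1
      · intro j _ hj
        simp [Pi.single_eq_of_ne hj]
      · simp
    · have := hI.antitone (not_lt.mp hi)
      rw [hI.mk_X_pow_eq_zero (by omega), map_zero, map_zero]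

theorem finrank_ker_syzygyMap (hI : IsStaircase I h) {a : ℕ} (ha : h a = 0) :
    Module.finrank ℂ (syzygyMap (Ideal.Quotient.mk I (X 0))
      (Ideal.Quotient.mk I (X 1)) h a).ker =
    2 * Module.finrank ℂ (MvPolynomial (Fin 2) ℂ ⧸ I) := by
  have := hI.finite_quotient ha
  set Φ := syzygyMap (Ideal.Quotient.mk I (X 0)) (Ideal.Quotient.mk I (X 1)) h a
  have h1 := Φ.finrank_range_add_finrank_ker
  have h2 := Φ.dualMap.finrank_range_add_finrank_ker
  rw [LinearMap.finrank_range_dualMap_eq_finrank_range, Subspace.dual_finrank_eq,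
    hI.finrank_ker_dualMap ha] at h2
  simp only [Module.finrank_pi_fintype, Finset.sum_const, Finset.card_univ, Fintype.card_fin,
    smul_eq_mul, add_mul, one_mul] at h1 h2
  omega

end IsStaircase

namespace IsStaircase

variable {I : Ideal (MvPolynomial (Fin 2) ℂ)} {h : ℕ → ℕ}

theorem le_of_forall_mem (hI : IsStaircase I h) {a : ℕ} (ha : h a = 0)
    {K : Ideal (MvPolynomial (Fin 2) ℂ)} (hK : ∀ i ≤ a, X 0 ^ i * X 1 ^ h i ∈ K) : I ≤ K := by
  intro f hf
  rw [f.as_sum]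
  refine K.sum_mem fun s hs => ?_
  have hs' := (hI.mem_iff f).mp hf s hs
  have hmin := hK (min (s 0) a) (min_le_right _ _)
  have hle : h (min (s 0) a) ≤ s 1 := by
    rcases le_total (s 0) a with hsa | hsa
    · rwa [min_eq_left hsa]
    · rw [min_eq_right hsa, ha]
      exact Nat.zero_le _
  have : (monomial s (coeff s f) : MvPolynomial (Fin 2) ℂ) =
      (C (coeff s f) * X 0 ^ (s 0 - min (s 0) a) * X 1 ^ (s 1 - h (min (s 0) a))) *
        (X 0 ^ min (s 0) a * X 1 ^ h (min (s 0) a)) := by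
    rw [monomial_eq, Finsupp.prod_fintype _ _ (by simp), Fin.prod_univ_two]
    conv_lhs => rw [← Nat.sub_add_cancel (min_le_left (s 0) a), ← Nat.sub_add_cancel hle]
    ring
  rw [this]
  exact K.mul_mem_left _ hmin

theorem exists_hom (hI : IsStaircase I h) (G : ℕ → MvPolynomial (Fin 2) ℂ ⧸ I)
    (hG : ∀ i, Ideal.Quotient.mk I (X 0) * G i =
      Ideal.Quotient.mk I (X 1) ^ (h i - h (i + 1)) * G (i + 1)) :
    ∃ φ : I →ₗ[MvPolynomial (Fin 2) ℂ] (MvPolynomial (Fin 2) ℂ ⧸ I),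
      ∀ i, φ ⟨X 0 ^ i * X 1 ^ h i, hI.X_pow_mem le_rfl⟩ = G i := by
  let F : MvPolynomial (Fin 2) ℂ →ₗ[ℂ] (MvPolynomial (Fin 2) ℂ ⧸ I) :=
    (basisMonomials (Fin 2) ℂ).constr ℂ fun s =>
      Ideal.Quotient.mk I (X 1) ^ (s 1 - h (s 0)) * G (s 0)
  have hF (s : Fin 2 →₀ ℕ) :
      F (monomial s 1) = Ideal.Quotient.mk I (X 1) ^ (s 1 - h (s 0)) * G (s 0) := by
    have := (basisMonomials (Fin 2) ℂ).constr_basis ℂ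
      (fun s => Ideal.Quotient.mk I (X 1) ^ (s 1 - h (s 0)) * G (s 0)) s
    simpa using this
  have hX (k : Fin 2) {f : MvPolynomial (Fin 2) ℂ} (hf : f ∈ I) :
      F (X k * f) = Ideal.Quotient.mk I (X k) * F f := by
    rw [← sub_eq_zero]
    refine hI.map_eq_zero (F ∘ₗ LinearMap.mulLeft ℂ (X k) -
      LinearMap.mulLeft ℂ (Ideal.Quotient.mk I (X k)) ∘ₗ F) (fun s hs => ?_) hf
    rw [LinearMap.sub_apply, LinearMap.comp_apply, LinearMap.comp_apply, LinearMap.mulLeft_apply,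
      LinearMap.mulLeft_apply, sub_eq_zero, X, monomial_mul, one_mul, hF, hF]
    fin_cases k
    · have := hI.antitone (Nat.le_succ (s 0))
      simp only [Fin.zero_eta, Finsupp.add_apply, Finsupp.single_apply, if_true, Nat.succ_eq_add_one,
        zero_add, show (0 : Fin 2) ≠ 1 from Fin.zero_ne_one, if_false] at this ⊢
      rw [mul_left_comm, ← X, hG, ← mul_assoc, ← pow_add, add_comm 1]
      congr 2
      omega
    · simp only [Fin.mk_one, Finsupp.add_apply, Finsupp.single_apply, if_true,
        zero_add, show (1 : Fin 2) ≠ 0 from Fin.zero_ne_one.symm, if_false]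
      rw [← X, ← mul_assoc, ← pow_succ']
      congr 2
      omega
  have hmul (p : MvPolynomial (Fin 2) ℂ) {f : MvPolynomial (Fin 2) ℂ} (hf : f ∈ I) :
      F (p * f) = Ideal.Quotient.mk I p * F f := by
    induction p using MvPolynomial.induction_on with
    | C r =>
      rw [← smul_eq_C_mul, map_smul]
      exact Algebra.smul_def r (F f)
    | add p q hp hq => rw [add_mul, map_add, hp, hq, map_add, add_mul]
    | mul_X p k hp => rw [mul_right_comm, mul_comm, hX k (I.mul_mem_left _ hf), hp, map_mul]; ring
  refine ⟨{ toFun := fun f => F f.1, map_add' := fun f g => map_add F f.1 g.1,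
            map_smul' := fun p f => hmul p f.2 }, fun i => ?_⟩
  have := hF (Finsupp.single 0 i + Finsupp.single 1 (h i))
  rw [show (monomial (Finsupp.single 0 i + Finsupp.single 1 (h i)) 1 : MvPolynomial (Fin 2) ℂ)
    = X 0 ^ i * X 1 ^ h i by simp [monomial_eq, Finsupp.prod_fintype]] at this
  replace this : F (X 0 ^ i * X 1 ^ h i) = G i := by simpa using this
  exact this

theorem finrank_hom (hI : IsStaircase I h) {a : ℕ} (ha : h a = 0) :
    Module.finrank ℂ (I →ₗ[MvPolynomial (Fin 2) ℂ] (MvPolynomial (Fin 2) ℂ ⧸ I)) =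
      2 * Module.finrank ℂ (MvPolynomial (Fin 2) ℂ ⧸ I) := by
  rw [← hI.finrank_ker_syzygyMap ha]
  have smul_eq (p : MvPolynomial (Fin 2) ℂ) (v : MvPolynomial (Fin 2) ℂ ⧸ I) :
      p • v = Ideal.Quotient.mk I p * v := Algebra.smul_def p v
  let g (i : ℕ) : I := ⟨X 0 ^ i * X 1 ^ h i, hI.X_pow_mem le_rfl⟩
  let ev : (I →ₗ[MvPolynomial (Fin 2) ℂ] (MvPolynomial (Fin 2) ℂ ⧸ I)) →ₗ[ℂ]
      (Fin (a + 1) → MvPolynomial (Fin 2) ℂ ⧸ I) :=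
    { toFun := fun φ i => φ (g i)
      map_add' := fun _ _ => rfl
      map_smul' := fun _ _ => rfl }
  have hinj : Function.Injective ev := by
    refine (injective_iff_map_eq_zero ev).mpr fun φ hφ => ?_
    have hK : I ≤ φ.ker.map I.subtype := hI.le_of_forall_mem ha fun i hi =>
      ⟨g i, congr_fun hφ ⟨i, Nat.lt_succ_of_le hi⟩, rfl⟩
    ext f
    obtain ⟨f', hf', hff'⟩ := hK f.2
    rw [← Subtype.ext hff']
    exact hf'
  have hrange : ev.range = (syzygyMap (Ideal.Quotient.mk I (X 0))
      (Ideal.Quotient.mk I (X 1)) h a).ker := by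
    apply le_antisymm
    · rintro _ ⟨φ, rfl⟩
      refine LinearMap.mem_ker.mpr (funext fun i => ?_)
      rw [syzygyMap_apply, Pi.zero_apply, sub_eq_zero, ← map_pow, ← smul_eq, ← smul_eq]
      change _ • φ (g i) = _ • φ (g (i + 1))
      rw [← map_smul, ← map_smul]
      congr 1
      ext1
      change (X 0 * (X 0 ^ (i : ℕ) * X 1 ^ h i) : MvPolynomial (Fin 2) ℂ) =
        X 1 ^ (h i - h (i + 1)) * (X 0 ^ (i + 1 : ℕ) * X 1 ^ h (i + 1))
      conv_lhs => rw [← Nat.sub_add_cancel (hI.antitone (Nat.le_succ i))]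
      rw [Nat.succ_eq_add_one]
      ring
    · intro u hu
      have hrel (i : Fin a) : syzygyMap (Ideal.Quotient.mk I (X 0)) (Ideal.Quotient.mk I (X 1))
          h a u i = 0 := congr_fun (LinearMap.mem_ker.mp hu) i
      simp only [syzygyMap_apply, sub_eq_zero] at hrel
      obtain ⟨φ, hφ⟩ := hI.exists_hom
        (fun i => if hi : i < a + 1 then u ⟨i, hi⟩
          else Ideal.Quotient.mk I (X 0) ^ (i - a) * u (Fin.last a)) (fun i => by
          rcases lt_trichotomy i a with hi | rfl | hi
          · rw [dif_pos (by omega), dif_pos (by omega)]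
            exact hrel ⟨i, hi⟩
          · rw [dif_pos (by omega), dif_neg (by omega), ha, Nat.add_sub_cancel_left]
            simp [Fin.last]
          · have h1 := hI.antitone hi.le
            rw [dif_neg (by omega), dif_neg (by omega), show h i - h (i + 1) = 0 by omega,
              pow_zero, one_mul, ← mul_assoc, ← pow_succ', Nat.sub_add_comm hi.le])
      refine ⟨φ, funext fun i => ?_⟩
      exact (hφ i).trans (dif_pos i.2)
  rw [← hrange, LinearMap.finrank_range_of_inj hinj]

end IsStaircase

theorem coeff_single_aeval_X {σ : Type*} (l : σ) (p : Polynomial ℂ) (n : ℕ) :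
    coeff (Finsupp.single l n) (Polynomial.aeval (X l : MvPolynomial σ ℂ) p) = p.coeff n := by
  classical
  rw [Polynomial.aeval_eq_sum_range, coeff_sum]
  simp only [coeff_smul, coeff_X_pow, smul_eq_mul, mul_ite, mul_one, mul_zero]
  simp only [(Finsupp.single_injective l).eq_iff, Finset.sum_ite_eq', Finset.mem_range]
  split_ifs with hn
  · rfl
  · exact (Polynomial.coeff_eq_zero_of_natDegree_lt (by omega)).symm

theorem finrank_eq_zero_of_injective_polynomial {V : Type*} [AddCommGroup V] [Module ℂ V]
    (f : Polynomial ℂ →ₗ[ℂ] V) (hf : ∀ p, f p = 0 → p = 0) : Module.finrank ℂ V = 0 := by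
  refine Module.finrank_of_not_finite fun hV => ?_
  exact Polynomial.not_finite (Module.Finite.of_injective f ((injective_iff_map_eq_zero f).mpr hf))

section InfiniteColength

variable {S : Set (Fin 2 →₀ ℕ)} {k l : Fin 2}

theorem finrank_quotient_eq_zero (hkl : l ≠ k) (hS : ∀ t ∈ S, t k ≠ 0) :
    Module.finrank ℂ (MvPolynomial (Fin 2) ℂ ⧸ Ideal.span
      ((fun s => (monomial s (1 : ℂ) : MvPolynomial (Fin 2) ℂ)) '' S)) = 0 := by
  refine finrank_eq_zero_of_injective_polynomial ((Ideal.Quotient.mkₐ ℂ _).toLinearMap ∘ₗ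
    (Polynomial.aeval (X l : MvPolynomial (Fin 2) ℂ)).toLinearMap) fun p hp => ?_
  have hp' := mem_ideal_span_monomial_image.mp (Ideal.Quotient.eq_zero_iff_mem.mp hp)
  ext n
  by_contra hn
  obtain ⟨t, ht, hle⟩ := hp' (Finsupp.single l n) (mem_support_iff.mpr (by
    rwa [AlgHom.toLinearMap_apply, coeff_single_aeval_X]))
  have := hle k
  rw [Finsupp.single_eq_of_ne hkl.symm] at this
  exact hS t ht (Nat.le_zero.mp this)

theorem finrank_hom_eq_zero (hkl : l ≠ k) (hS : ∀ t ∈ S, t k ≠ 0)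
    {I : Ideal (MvPolynomial (Fin 2) ℂ)}
    (hI : I = Ideal.span ((fun s => (monomial s (1 : ℂ) : MvPolynomial (Fin 2) ℂ)) '' S)) :
    Module.finrank ℂ (I →ₗ[MvPolynomial (Fin 2) ℂ] (MvPolynomial (Fin 2) ℂ ⧸ I)) = 0 := by
  rcases S.eq_empty_or_nonempty with rfl | hne
  · have : I = ⊥ := by simp [hI]
    subst this
    exact Module.finrank_zero_of_subsingleton
  obtain ⟨t, ht, hmin⟩ := exists_minimalFor_of_wellFoundedLT (· ∈ S) (fun t => t k) hne
  have hle : I ≤ Submodule.span (MvPolynomial (Fin 2) ℂ) {(X k : MvPolynomial (Fin 2) ℂ)} := by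
    rw [hI, Ideal.span_le]
    rintro _ ⟨s, hs, rfl⟩
    refine Ideal.mem_span_singleton.mpr ?_
    rw [X_dvd_monomial]
    exact Or.inr (hS s hs)
  let D : I →ₗ[MvPolynomial (Fin 2) ℂ] MvPolynomial (Fin 2) ℂ :=
    (LinearEquiv.toSpanNonzeroSingleton _ _ (X k : MvPolynomial (Fin 2) ℂ)
      (X_ne_zero k)).symm.toLinearMap ∘ₗ Submodule.inclusion hle
  have hD (f : I) : D f * X k = f.1 := by
    have := (LinearEquiv.toSpanNonzeroSingleton _ _ (X k : MvPolynomial (Fin 2) ℂ)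
      (X_ne_zero k)).apply_symm_apply (Submodule.inclusion hle f)
    exact congrArg Subtype.val this
  let Θ : Polynomial ℂ →ₗ[ℂ] (I →ₗ[MvPolynomial (Fin 2) ℂ] (MvPolynomial (Fin 2) ℂ ⧸ I)) :=
    { toFun := fun p => I.mkQ ∘ₗ (Polynomial.aeval (X l : MvPolynomial (Fin 2) ℂ) p • D)
      map_add' := fun p q => by
        ext f
        simp [add_mul]
      map_smul' := fun r p => by
        ext f
        simp }
  refine finrank_eq_zero_of_injective_polynomial Θ fun p hp => ?_
  have htI : monomial t (1 : ℂ) ∈ I := hI ▸ Ideal.subset_span ⟨t, ht, rfl⟩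
  have hDt : D ⟨_, htI⟩ = monomial (t - Finsupp.single k 1) 1 := by
    refine mul_right_cancel₀ (X_ne_zero (R := ℂ) k) ?_
    rw [hD, X, monomial_mul, mul_one, tsub_add_cancel_of_le]
    simpa [Nat.one_le_iff_ne_zero] using hS t ht
  have hmem : Polynomial.aeval (X l : MvPolynomial (Fin 2) ℂ) p *
      monomial (t - Finsupp.single k 1) 1 ∈ I := by
    have := LinearMap.congr_fun hp ⟨_, htI⟩
    rw [← hDt]
    exact Ideal.Quotient.eq_zero_iff_mem.mp this
  have hp' := mem_ideal_span_monomial_image.mp (hI ▸ hmem)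
  ext n
  by_contra hn
  obtain ⟨s, hs, hle⟩ := hp' (Finsupp.single l n + (t - Finsupp.single k 1))
    (mem_support_iff.mpr (by rwa [coeff_mul_monomial, coeff_single_aeval_X, mul_one]))
  have h1 := hle k
  have h2 := hmin hs
  have h3 := hS t ht
  simp only [Finsupp.add_apply, Finsupp.single_eq_of_ne hkl.symm, Finsupp.tsub_apply,
    Finsupp.single_eq_same] at h1 h2
  omega

end InfiniteColength

theorem exists_isStaircase {S : Set (Fin 2 →₀ ℕ)} (h0 : ∃ t ∈ S, t 0 = 0) :
    ∃ h, IsStaircase (Ideal.span ((fun s => (monomial s (1 : ℂ) : MvPolynomial (Fin 2) ℂ)) '' S)) h ∧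
      ∀ t ∈ S, h (t 0) ≤ t 1 := by
  let J (i : ℕ) : Set ℕ := {j | ∃ t ∈ S, t 0 ≤ i ∧ t 1 ≤ j}
  have hJ (i : ℕ) : sInf (J i) ∈ J i := by
    obtain ⟨t, ht, ht0⟩ := h0
    exact Nat.sInf_mem ⟨t 1, t, ht, by omega, le_rfl⟩
  refine ⟨fun i => sInf (J i), ⟨fun i i' hii => ?_, fun f => ?_⟩,
    fun t ht => Nat.sInf_le ⟨t, ht, le_rfl, le_rfl⟩⟩
  · obtain ⟨t, ht, h1, h2⟩ := hJ i
    exact Nat.sInf_le ⟨t, ht, h1.trans hii, h2⟩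
  · rw [mem_ideal_span_monomial_image]
    refine forall₂_congr fun s _ => ⟨?_, fun hs => ?_⟩
    · rintro ⟨t, ht, hle⟩
      exact Nat.sInf_le ⟨t, ht, hle 0, hle 1⟩
    · obtain ⟨t, ht, h1, h2⟩ := hJ (s 0)
      refine ⟨t, ht, fun k => ?_⟩
      fin_cases k
      · exact h1
      · exact h2.trans hs

/-- For a monomial ideal `I ⊆ ℂ[x,y]` of colength `n`, the tangent space
`Hom_R(I, R/I)` of the Hilbert scheme of points has dimension `2n`. -/
theorem hilb_two_dim_smooth (n : ℕ) (I : Ideal (MvPolynomial (Fin 2) ℂ))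
    (hI : IsMonomialIdeal I)
    (hn : Module.finrank ℂ (MvPolynomial (Fin 2) ℂ ⧸ I) = n) :
    Module.finrank ℂ (↥I →ₗ[MvPolynomial (Fin 2) ℂ] (MvPolynomial (Fin 2) ℂ ⧸ I)) = 2 * n := by
  subst hn
  obtain ⟨S, hS⟩ := hI
  by_cases h0 : ∃ t ∈ S, t 0 = 0
  · by_cases h1 : ∃ t ∈ S, t 1 = 0
    · obtain ⟨h, hh, hS'⟩ := exists_isStaircase h0
      rw [← hS] at hh
      obtain ⟨t, ht, ht1⟩ := h1
      exact hh.finrank_hom (Nat.le_zero.mp (ht1 ▸ hS' t ht))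
    · push Not at h1
      rw [finrank_hom_eq_zero Fin.zero_ne_one h1 hS, hS, finrank_quotient_eq_zero Fin.zero_ne_one h1]
  · push Not at h0
    rw [finrank_hom_eq_zero Fin.zero_ne_one.symm h0 hS, hS,
      finrank_quotient_eq_zero Fin.zero_ne_one.symm h0]
end

section
/- Let $I \subset J$ be monomial ideals of $R = \mathbb{C}[x,y]$ with $\dim_{\mathbb{C}} R/I = n$ and $\dim_{\mathbb{C}} R/J = m$, and suppose the set of monomials lying in $J$ but not in $I$ forms a rectangle in exponent space (i.e. is of the form $\{x^ay^b : a_0 \le a < a_0 + w,\ b_0 \le b < b_0 + h\}$ for some $a_0,b_0,w,h$). Let $\psi: \operatorname{Hom}_R(I,R/I) \to \operatorname{Hom}_R(I,R/J)$ and $\phi: \operatorname{Hom}_R(J,R/J) \to \operatorname{Hom}_R(I,R/J)$ be the maps induced by the projection $R/I \to R/J$ and the inclusion $I \subset J$. Then $\dim_{\mathbb{C}} \operatorname{Ker}(\psi - \phi) = 2n$, where $(\psi-\phi)(f_1,f_2) = \psi(f_1) - \phi(f_2)$. -/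
variable (k : Type*) {R : Type*} [Field k] [CommRing R] [Algebra k R]

/-- The map `Hom_R(I, R/I) → Hom_R(I, R/J)` induced by the projection `R/I → R/J`. -/
noncomputable def psiMap (I J : Ideal R) (h : I ≤ J) :
    (↥I →ₗ[R] R ⧸ I) →ₗ[k] (↥I →ₗ[R] R ⧸ J) where
  toFun f := (Submodule.mapQ I J LinearMap.id fun _ hx => h hx).comp f
  map_add' f g := by simp [LinearMap.comp_add]
  map_smul' c f := by ext x; simp

/-- The map `Hom_R(J, R/J) → Hom_R(I, R/J)` induced by the inclusion `I ⊆ J`. -/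
noncomputable def phiMap (I J : Ideal R) (h : I ≤ J) :
    (↥J →ₗ[R] R ⧸ J) →ₗ[k] (↥I →ₗ[R] R ⧸ J) where
  toFun g := g.comp (Submodule.inclusion h)
  map_add' f g := by ext x; simp
  map_smul' c f := by ext x; simp

/-- The map `(f₁, f₂) ↦ ψ f₁ - φ f₂` on `Hom_R(I,R/I) ⊕ Hom_R(J,R/J)`. -/
noncomputable def psiMinusPhi (I J : Ideal R) (h : I ≤ J) :
    ((↥I →ₗ[R] R ⧸ I) × (↥J →ₗ[R] R ⧸ J)) →ₗ[k] (↥I →ₗ[R] R ⧸ J) :=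
  (psiMap k I J h).comp (LinearMap.fst k _ _) - (phiMap k I J h).comp (LinearMap.snd k _ _)

open MvPolynomial

section TraceForm

open LinearMap Module

variable {K V : Type*} [Field K] [AddCommGroup V] [Module K V]

theorem Submodule.finrank_map_add_finrank_inf_ker {W : Type*} [AddCommGroup W] [Module K W]
    [FiniteDimensional K V] (f : V →ₗ[K] W) (Q : Submodule K V) :
    finrank K (Q.map f) + finrank K ↥(Q ⊓ ker f) = finrank K Q := by
  have h := (f.domRestrict Q).finrank_range_add_finrank_ker
  rw [LinearMap.range_domRestrict, LinearMap.ker_domRestrict] at h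
  rw [← h, ← Submodule.map_comap_subtype, Submodule.finrank_map_subtype_eq]

variable (K V) in
/-- The trace pairing `(φ, ψ) ↦ tr (φ ψ)` on endomorphisms. -/
noncomputable def endTraceForm : LinearMap.BilinForm K (End K V) :=
  (LinearMap.mul K (End K V)).compr₂ (LinearMap.trace K V)

theorem endTraceForm_apply (φ ψ : End K V) :
    endTraceForm K V φ ψ = LinearMap.trace K V (φ * ψ) := rfl

variable [FiniteDimensional K V]

theorem endTraceForm_smulRight (ξ : V →ₗ[K] K) (v : V) (ψ : End K V) :
    endTraceForm K V (ξ.smulRight v) ψ = ξ (ψ v) := by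
  have h : ψ * ξ.smulRight v = ξ.smulRight (ψ v) := by ext; simp
  rw [endTraceForm_apply, LinearMap.trace_mul_comm, h, LinearMap.trace_smulRight]

theorem ker_endTraceForm : LinearMap.ker (endTraceForm K V) = ⊥ := by
  refine (Submodule.eq_bot_iff _).2 fun φ hφ => LinearMap.ext fun v => ?_
  refine (forall_dual_apply_eq_zero_iff K _).1 fun ξ => ?_
  rw [← endTraceForm_smulRight ξ v φ, endTraceForm_apply, LinearMap.trace_mul_comm,
    ← endTraceForm_apply, LinearMap.mem_ker.1 hφ, LinearMap.zero_apply]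

theorem finrank_add_finrank_orthogonal_endTraceForm (W : Submodule K (End K V)) :
    finrank K W + finrank K ((endTraceForm K V).orthogonal W) = finrank K (End K V) := by
  rw [LinearMap.BilinForm.finrank_add_finrank_orthogonal', ker_endTraceForm, inf_bot_eq,
    finrank_bot, add_zero]

/-- The endomorphisms preserving a subspace. -/
def parabolic (N : Submodule K V) : Submodule K (End K V) where
  carrier := {φ | ∀ v ∈ N, φ v ∈ N}
  add_mem' h₁ h₂ v hv := N.add_mem (h₁ v hv) (h₂ v hv)
  zero_mem' _ _ := N.zero_mem
  smul_mem' c _ h v hv := N.smul_mem c (h v hv)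

/-- The endomorphisms that kill a subspace and take values in it. -/
def parabolicRadical (N : Submodule K V) : Submodule K (End K V) where
  carrier := {φ | (∀ v ∈ N, φ v = 0) ∧ ∀ v, φ v ∈ N}
  add_mem' h₁ h₂ := ⟨fun v hv => by simp [h₁.1 v hv, h₂.1 v hv],
    fun v => N.add_mem (h₁.2 v) (h₂.2 v)⟩
  zero_mem' := ⟨fun _ _ => rfl, fun _ => N.zero_mem⟩
  smul_mem' c _ h := ⟨fun v hv => by simp [h.1 v hv], fun v => N.smul_mem c (h.2 v)⟩

theorem orthogonal_parabolic (N : Submodule K V) :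
    (endTraceForm K V).orthogonal (parabolic N) = parabolicRadical N := by
  ext ψ
  rw [LinearMap.BilinForm.mem_orthogonal_iff]
  refine ⟨fun h => ⟨fun v hv => ?_, fun v => ?_⟩, fun h φ hφ => ?_⟩
  · refine (forall_dual_apply_eq_zero_iff K _).1 fun ξ => ?_
    rw [← endTraceForm_smulRight]
    exact h _ fun w _ => N.smul_mem _ hv
  · by_contra hv
    obtain ⟨ξ, hξ, hN⟩ := N.exists_le_ker_of_notMem hv
    apply hξ
    rw [← endTraceForm_smulRight]
    refine h _ fun w hw => ?_
    simp [LinearMap.mem_ker.1 (hN hw)]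
  · have hnil : IsNilpotent (φ * ψ) := by
      refine ⟨2, LinearMap.ext fun v => ?_⟩
      simp [pow_two, h.1 _ (hφ _ (h.2 v))]
    exact (LinearMap.isNilpotent_trace_of_isNilpotent hnil).eq_zero

end TraceForm

section Deformations

open LinearMap Module

variable {K V : Type*} [Field K] [AddCommGroup V] [Module K V]
  [Module (MvPolynomial (Fin 2) K) V] [IsScalarTower K (MvPolynomial (Fin 2) K) V]

variable (V) in
/-- The commutator `φ ↦ r φ - φ r` with the action of `r`. -/
noncomputable def adSMul (r : MvPolynomial (Fin 2) K) : End K V →ₗ[K] End K V :=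
  LinearMap.mulLeft K (Algebra.lsmul K K V r) - LinearMap.mulRight K (Algebra.lsmul K K V r)

theorem adSMul_apply (r : MvPolynomial (Fin 2) K) (φ : End K V) (v : V) :
    adSMul V r φ v = r • φ v - φ (r • v) := by
  simp [adSMul]

theorem endTraceForm_adSMul (r : MvPolynomial (Fin 2) K) (φ ψ : End K V) :
    endTraceForm K V (adSMul V r φ) ψ = - endTraceForm K V φ (adSMul V r ψ) := by
  simp only [endTraceForm_apply, adSMul, LinearMap.sub_apply, mulLeft_apply, mulRight_apply,
    map_sub]
  rw [mul_assoc, LinearMap.trace_mul_comm K (Algebra.lsmul K K V r), mul_assoc, mul_assoc]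
  abel

/-- The map `(A, B) ↦ [X₀, B] - [X₁, A]` on endomorphisms preserving `N`. -/
noncomputable def commutatorMap (N : Submodule (MvPolynomial (Fin 2) K) V) :
    parabolic (N.restrictScalars K) × parabolic (N.restrictScalars K) →ₗ[K] End K V :=
  (adSMul V (X 0) ∘ₗ Submodule.subtype _) ∘ₗ LinearMap.snd K _ _ -
    (adSMul V (X 1) ∘ₗ Submodule.subtype _) ∘ₗ LinearMap.fst K _ _

theorem commutatorMap_apply (N : Submodule (MvPolynomial (Fin 2) K) V)
    (A B : parabolic (N.restrictScalars K)) :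
    commutatorMap N (A, B) = adSMul V (X 0) B - adSMul V (X 1) A := rfl

/-- The endomorphisms commuting with the action modulo `parabolicRadical`. -/
noncomputable def almostLinear (N : Submodule (MvPolynomial (Fin 2) K) V) :
    Submodule K (End K V) :=
  ⨅ r : MvPolynomial (Fin 2) K, (parabolicRadical (N.restrictScalars K)).comap (adSMul V r)

theorem mem_almostLinear_of_X {N : Submodule (MvPolynomial (Fin 2) K) V} {ψ : End K V}
    (h : ∀ i, adSMul V (X i) ψ ∈ parabolicRadical (N.restrictScalars K)) : ψ ∈ almostLinear N := by
  refine Submodule.mem_iInf _ |>.2 fun r => ?_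
  rw [Submodule.mem_comap]
  induction r using MvPolynomial.induction_on with
  | C a =>
    convert Submodule.zero_mem _
    ext v
    have (w : V) : (C a : MvPolynomial (Fin 2) K) • w = a • w := by
      rw [← algebraMap_eq, algebraMap_smul]
    simp [adSMul_apply, this]
  | add p q hp hq =>
    convert Submodule.add_mem _ hp hq
    ext v
    simp [adSMul_apply, add_smul]
    abel
  | mul_X p i hp =>
    have key (v : V) : adSMul V (p * X i) ψ v =
        p • adSMul V (X i) ψ v + adSMul V p ψ ((X i : MvPolynomial (Fin 2) K) • v) := by
      simp [adSMul_apply, mul_smul, smul_sub]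
    refine ⟨fun v hv => ?_, fun v => ?_⟩
    · rw [key, (h i).1 v hv, hp.1 _ (N.smul_mem _ hv)]; simp
    · rw [key]
      exact N.add_mem (N.smul_mem _ ((h i).2 v)) (hp.2 _)

variable [FiniteDimensional K V]

theorem orthogonal_range_commutatorMap (N : Submodule (MvPolynomial (Fin 2) K) V) :
    (endTraceForm K V).orthogonal (range (commutatorMap N)) = almostLinear N := by
  ext ψ
  rw [LinearMap.BilinForm.mem_orthogonal_iff]
  refine ⟨fun h => mem_almostLinear_of_X fun i => ?_, ?_⟩
  · rw [← orthogonal_parabolic, LinearMap.BilinForm.mem_orthogonal_iff]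
    intro φ hφ
    fin_cases i
    · have := h _ ⟨(0, ⟨φ, hφ⟩), rfl⟩
      simpa [commutatorMap_apply, endTraceForm_adSMul] using this
    · have := h _ ⟨(⟨φ, hφ⟩, 0), rfl⟩
      simpa [commutatorMap_apply, endTraceForm_adSMul] using this
  · rintro h _ ⟨⟨A, B⟩, rfl⟩
    have hr (r : MvPolynomial (Fin 2) K) (φ : parabolic (N.restrictScalars K)) :
        endTraceForm K V φ (adSMul V r ψ) = 0 := by
      have := (Submodule.mem_iInf _).1 h r
      rw [Submodule.mem_comap, ← orthogonal_parabolic] at this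
      exact LinearMap.BilinForm.mem_orthogonal_iff.1 this _ φ.2
    simp [commutatorMap_apply, endTraceForm_adSMul, hr]

theorem finrank_almostLinear (N : Submodule (MvPolynomial (Fin 2) K) V) {e g : V}
    (he : ∀ v : V, ∃ r : MvPolynomial (Fin 2) K, r • e = v)
    (hgN : g ∈ N) (hg : ∀ v ∈ N, ∃ r : MvPolynomial (Fin 2) K, r • g = v) :
    finrank K (almostLinear N) =
      finrank K V + finrank K (parabolicRadical (N.restrictScalars K)) := by
  set M := N.restrictScalars K with hM
  have lin {ψ : End K V} (hψ : ψ ∈ almostLinear N) (r : MvPolynomial (Fin 2) K) :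
      adSMul V r ψ ∈ parabolicRadical M := (Submodule.mem_iInf _).1 hψ r
  let f₁ : End K V →ₗ[K] V ⧸ M := M.mkQ ∘ₗ LinearMap.applyₗ e
  let f₂ : End K V →ₗ[K] V := LinearMap.applyₗ g
  have hf₁ (ψ : End K V) : ψ ∈ ker f₁ ↔ ψ e ∈ N := Submodule.Quotient.mk_eq_zero M
  have h₁ : (almostLinear N).map f₁ = ⊤ := by
    refine eq_top_iff.2 fun u _ => ?_
    obtain ⟨v, rfl⟩ := M.mkQ_surjective u
    obtain ⟨r, rfl⟩ := he v
    refine ⟨Algebra.lsmul K K V r, mem_almostLinear_of_X fun i => ?_, rfl⟩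
    convert Submodule.zero_mem _
    ext v
    simp [adSMul_apply, smul_comm r (X i)]
  have h₂ : (almostLinear N ⊓ ker f₁).map f₂ = M := by
    refine le_antisymm ?_ fun v hv => ?_
    · rintro _ ⟨ψ, ⟨hψ, hψ₁⟩, rfl⟩
      obtain ⟨r, rfl⟩ := he g
      have hψe : ψ e ∈ N := (hf₁ ψ).1 hψ₁
      have := (lin hψ r).2 e
      rw [adSMul_apply] at this
      exact (N.sub_mem_iff_right (N.smul_mem _ hψe)).1 this
    · obtain ⟨r, rfl⟩ := hg v hv
      obtain ⟨p, hp⟩ := M.subtype.exists_leftInverse_of_injective M.ker_subtype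
      have hp' (v : V) (hv : v ∈ N) : (p v : V) = v :=
        congrArg Subtype.val (LinearMap.congr_fun hp ⟨v, hv⟩)
      let ψ : End K V := Algebra.lsmul K K V r ∘ₗ M.subtype ∘ₗ p
      have hψN (v : V) : ψ v ∈ N := N.smul_mem r (p v).2
      refine ⟨ψ, ⟨mem_almostLinear_of_X fun i => ⟨fun v hv => ?_, fun v => ?_⟩, ?_⟩, ?_⟩
      · simp [adSMul_apply, ψ, hp' v hv, hp' _ (N.smul_mem (X i) hv), smul_comm r (X i)]
      · rw [adSMul_apply]
        exact N.sub_mem (N.smul_mem _ (hψN v)) (hψN _)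
      · exact (hf₁ ψ).2 (hψN e)
      · simp [f₂, ψ, hp' g hgN]
  have h₃ : almostLinear N ⊓ ker f₁ ⊓ ker f₂ = parabolicRadical M := by
    refine le_antisymm ?_ fun ψ hψ => ⟨⟨mem_almostLinear_of_X fun i => ⟨fun v hv => ?_,
      fun v => ?_⟩, ?_⟩, ?_⟩
    · rintro ψ ⟨⟨hψ, hψ₁⟩, hψ₂⟩
      have hψe : ψ e ∈ N := (hf₁ ψ).1 hψ₁
      refine ⟨fun v hv => ?_, fun v => ?_⟩
      · obtain ⟨r, rfl⟩ := hg v hv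
        have := (lin hψ r).1 g hgN
        rw [adSMul_apply, show ψ g = 0 from hψ₂] at this
        simpa using this
      · obtain ⟨r, rfl⟩ := he v
        have := (lin hψ r).2 e
        rw [adSMul_apply] at this
        exact (N.sub_mem_iff_right (N.smul_mem _ hψe)).1 this
    · rw [adSMul_apply, hψ.1 v hv, hψ.1 _ (N.smul_mem _ hv)]; simp
    · rw [adSMul_apply]
      exact N.sub_mem (N.smul_mem _ (hψ.2 v)) (hψ.2 _)
    · exact (hf₁ ψ).2 (hψ.2 e)
    · exact hψ.1 g hgN
  have e₁ := Submodule.finrank_map_add_finrank_inf_ker f₁ (almostLinear N)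
  have e₂ := Submodule.finrank_map_add_finrank_inf_ker f₂ (almostLinear N ⊓ ker f₁)
  have e₃ := M.finrank_quotient_add_finrank
  rw [h₁, finrank_top] at e₁
  rw [h₂, h₃] at e₂
  omega

theorem finite_ker_commutatorMap (N : Submodule (MvPolynomial (Fin 2) K) V) :
    Module.Finite K (ker (commutatorMap N)) :=
  inferInstance

theorem finrank_ker_commutatorMap (N : Submodule (MvPolynomial (Fin 2) K) V) {e g : V}
    (he : ∀ v : V, ∃ r : MvPolynomial (Fin 2) K, r • e = v)
    (hgN : g ∈ N) (hg : ∀ v ∈ N, ∃ r : MvPolynomial (Fin 2) K, r • g = v) :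
    finrank K (ker (commutatorMap N)) =
      finrank K V + finrank K (parabolic (N.restrictScalars K)) := by
  have h₁ := (commutatorMap N).finrank_range_add_finrank_ker
  have h₂ := finrank_add_finrank_orthogonal_endTraceForm (range (commutatorMap N))
  have h₃ := finrank_add_finrank_orthogonal_endTraceForm (parabolic (N.restrictScalars K))
  rw [orthogonal_range_commutatorMap, finrank_almostLinear N he hgN hg] at h₂
  rw [orthogonal_parabolic] at h₃
  rw [finrank_prod] at h₁
  omega

end Deformations

section TangentSpace

open LinearMap Module

variable {K : Type*} [Field K]

section Dimension

variable {M Q A B : Type*} [AddCommGroup M] [Module K M] [AddCommGroup Q] [Module K Q]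
  [AddCommMonoid A] [Module K A] [AddCommMonoid B] [Module K B]

theorem Submodule.finrank_range_add_of_map_ker_eq {P : Submodule K M} [Module.Finite K P]
    {f : P →ₗ[K] Q} {S : Submodule K A} {a : A →ₗ[K] M} (ha : Function.Injective a)
    (hker : (ker f).map P.subtype = S.map a) :
    finrank K (range f) + finrank K S = finrank K P := by
  rw [← f.finrank_range_add_finrank_ker, ← Submodule.finrank_map_subtype_eq P (ker f), hker,
    (Submodule.equivMapOfInjective a ha S).finrank_eq]

theorem Submodule.finite_and_finrank_of_map_ker_eq [Module.Finite K A] {P : Submodule K M}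
    {f : P →ₗ[K] Q} {a : A →ₗ[K] M} (ha : Function.Injective a)
    (hker : (ker f).map P.subtype = range a) {S : Submodule K B} [Module.Finite K S]
    {b : B →ₗ[K] Q} (hb : Function.Injective b) (hran : range f = S.map b) :
    Module.Finite K P ∧ finrank K S + finrank K A = finrank K P := by
  have h₁ : (ker f).FG := by
    refine Submodule.fg_of_fg_map_injective P.subtype P.subtype_injective ?_
    rw [hker]
    exact Module.Finite.iff_fg.1 inferInstance
  have h₂ : (range f).FG := by
    rw [hran]
    exact Module.Finite.iff_fg.1 inferInstance
  have hP : Module.Finite K P := by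
    refine ⟨Submodule.fg_of_fg_map_of_fg_inf_ker f ?_ (by rwa [top_inf_eq])⟩
    rwa [Submodule.map_top]
  refine ⟨hP, ?_⟩
  rw [← f.finrank_range_add_finrank_ker, ← Submodule.finrank_map_subtype_eq P (ker f), hker,
    LinearMap.finrank_range_of_inj ha, hran, (Submodule.equivMapOfInjective b hb S).finrank_eq]

end Dimension

theorem exists_linearMap_of_commute {W : Type*} [AddCommGroup W] [Module K W]
    (E : Fin 2 → End K W) (hE : Commute (E 0) (E 1)) (w : W) :
    ∃ G : MvPolynomial (Fin 2) K →ₗ[K] W, G 1 = w ∧ ∀ i r, G (X i * r) = E i (G r) := by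
  let G : MvPolynomial (Fin 2) K →ₗ[K] W :=
    (basisMonomials (Fin 2) K).constr K fun s => (E 0 ^ s 0 * E 1 ^ s 1) w
  have hmon (s : Fin 2 →₀ ℕ) : G (monomial s 1) = (E 0 ^ s 0 * E 1 ^ s 1) w := by
    have := (basisMonomials (Fin 2) K).constr_basis K (fun s => (E 0 ^ s 0 * E 1 ^ s 1) w) s
    rwa [coe_basisMonomials] at this
  refine ⟨G, by simpa using hmon 0, fun i r => ?_⟩
  suffices h : G ∘ₗ LinearMap.mulLeft K (X i) = E i ∘ₗ G from LinearMap.congr_fun h r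
  refine (basisMonomials (Fin 2) K).ext fun s => ?_
  simp only [coe_basisMonomials, LinearMap.comp_apply, LinearMap.mulLeft_apply]
  rw [X, monomial_mul, one_mul, hmon, hmon, ← Module.End.mul_apply]
  fin_cases i
  · simp [pow_add, ← mul_assoc]
  · simp only [Fin.mk_one, Finsupp.coe_add, Pi.add_apply, Finsupp.single_apply]
    rw [← mul_assoc, ← (hE.pow_left (s 0)).eq]
    simp [pow_add, mul_assoc]

section Primitive

variable {V : Type*} [AddCommGroup V] [Module K V] [Module (MvPolynomial (Fin 2) K) V]
  [IsScalarTower K (MvPolynomial (Fin 2) K) V]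

theorem exists_primitive (A : Fin 2 → End K V) (e : V)
    (hA : adSMul V (X 0) (A 1) = adSMul V (X 1) (A 0)) :
    ∃ F : MvPolynomial (Fin 2) K →ₗ[K] V,
      ∀ i (r : MvPolynomial (Fin 2) K),
        (X i : MvPolynomial (Fin 2) K) • F r - F (X i * r) = A i (r • e) := by
  let L (i : Fin 2) : End K V := Algebra.lsmul K K V (X i : MvPolynomial (Fin 2) K)
  let E (i : Fin 2) : End K (V × V) :=
    (L i ∘ₗ LinearMap.fst K V V - A i ∘ₗ LinearMap.snd K V V).prod (L i ∘ₗ LinearMap.snd K V V)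
  have hE : Commute (E 0) (E 1) := by
    refine LinearMap.ext fun ⟨v, u⟩ => ?_
    have := LinearMap.congr_fun hA u
    rw [adSMul_apply, adSMul_apply] at this
    refine Prod.ext ?_ ?_
    · change (X 0 : MvPolynomial (Fin 2) K) • ((X 1 : MvPolynomial (Fin 2) K) • v - A 1 u) -
          A 0 ((X 1 : MvPolynomial (Fin 2) K) • u) =
        (X 1 : MvPolynomial (Fin 2) K) • ((X 0 : MvPolynomial (Fin 2) K) • v - A 0 u) -
          A 1 ((X 0 : MvPolynomial (Fin 2) K) • u)
      rw [smul_sub, smul_sub,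
        smul_comm (X 0 : MvPolynomial (Fin 2) K) (X 1 : MvPolynomial (Fin 2) K) v, sub_sub,
        sub_sub, sub_right_inj]
      rw [sub_eq_sub_iff_add_eq_add] at this
      rw [this, add_comm]
    · simp [E, L, smul_comm (X 0 : MvPolynomial (Fin 2) K) (X 1 : MvPolynomial (Fin 2) K) u]
  obtain ⟨G, hG₁, hG⟩ := exists_linearMap_of_commute E hE (0, e)
  have hsnd (r : MvPolynomial (Fin 2) K) : (G r).2 = r • e := by
    induction r using MvPolynomial.induction_on with
    | C a =>
      have : (C a : MvPolynomial (Fin 2) K) = a • 1 := by rw [smul_eq_C_mul, mul_one]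
      rw [this, map_smul, hG₁]
      simp
    | add p q hp hq => simp [hp, hq, add_smul]
    | mul_X p i hp =>
      rw [mul_comm, hG, mul_smul, ← hp]
      rfl
  refine ⟨LinearMap.fst K V V ∘ₗ G, fun i r => ?_⟩
  simp [hG, E, L, hsnd]

end Primitive

section Restriction

variable {V W : Type*} [AddCommGroup V] [Module K V] [Module (MvPolynomial (Fin 2) K) V]
  [AddCommGroup W] [Module K W] [Module (MvPolynomial (Fin 2) K) W]
  [IsScalarTower K (MvPolynomial (Fin 2) K) V] [IsScalarTower K (MvPolynomial (Fin 2) K) W]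

/-- The `K`-linear maps `F : R → V` such that `q ∘ F` is `R`-linear on the ideal `M`. -/
def linearOn (M : Ideal (MvPolynomial (Fin 2) K)) (q : V →ₗ[MvPolynomial (Fin 2) K] W) :
    Submodule K (MvPolynomial (Fin 2) K →ₗ[K] V) where
  carrier := {F | ∀ i, ∀ r ∈ M, q (F (X i * r)) = (X i : MvPolynomial (Fin 2) K) • q (F r)}
  add_mem' h₁ h₂ i r hr := by simp [h₁ i r hr, h₂ i r hr]
  zero_mem' i r hr := by simp
  smul_mem' c F h i r hr := by
    simp only [LinearMap.smul_apply, LinearMap.map_smul_of_tower, h i r hr]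
    rw [smul_comm]

theorem linearOn_map_mul {M : Ideal (MvPolynomial (Fin 2) K)}
    {q : V →ₗ[MvPolynomial (Fin 2) K] W} {F : MvPolynomial (Fin 2) K →ₗ[K] V}
    (hF : F ∈ linearOn M q) (p : MvPolynomial (Fin 2) K) {r : MvPolynomial (Fin 2) K}
    (hr : r ∈ M) : q (F (p * r)) = p • q (F r) := by
  induction p using MvPolynomial.induction_on generalizing r with
  | C a =>
    rw [← smul_eq_C_mul, map_smul, LinearMap.map_smul_of_tower, ← algebraMap_eq, algebraMap_smul]
  | add p₁ p₂ h₁ h₂ => simp [add_mul, add_smul, h₁ hr, h₂ hr]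
  | mul_X p i hp => rw [mul_assoc, hp (M.mul_mem_left _ hr), hF i r hr, mul_smul]

/-- The restriction of `q ∘ F` to `M`. -/
noncomputable def linearOnRestrict (M : Ideal (MvPolynomial (Fin 2) K))
    (q : V →ₗ[MvPolynomial (Fin 2) K] W) : linearOn M q →ₗ[K] (M →ₗ[MvPolynomial (Fin 2) K] W) where
  toFun F :=
    { toFun := fun r => q (F.1 r)
      map_add' := by simp
      map_smul' := fun p r => linearOn_map_mul F.2 p r.2 }
  map_add' F G := by ext; simp
  map_smul' c F := by ext; simp [LinearMap.map_smul_of_tower]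

end Restriction

variable {I J : Ideal (MvPolynomial (Fin 2) K)} (h : I ≤ J)

/-- The projection `R/I → R/J`. -/
noncomputable def quotProj :
    (MvPolynomial (Fin 2) K ⧸ I) →ₗ[MvPolynomial (Fin 2) K] MvPolynomial (Fin 2) K ⧸ J :=
  Submodule.mapQ I J LinearMap.id fun _ hx => h hx

theorem mk_mem_ker_quotProj {r : MvPolynomial (Fin 2) K} :
    (Submodule.Quotient.mk r : MvPolynomial (Fin 2) K ⧸ I) ∈ ker (quotProj h) ↔ r ∈ J :=
  Submodule.Quotient.mk_eq_zero J

/-- The linear maps `R → R/I` representing tangent vectors. -/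
noncomputable def tangentLifts :
    Submodule K (MvPolynomial (Fin 2) K →ₗ[K] MvPolynomial (Fin 2) K ⧸ I) :=
  linearOn I LinearMap.id ⊓ linearOn J (quotProj h)

/-- The pair of homomorphisms represented by an element of `tangentLifts`. -/
noncomputable def toTangent : tangentLifts h →ₗ[K]
    (I →ₗ[MvPolynomial (Fin 2) K] MvPolynomial (Fin 2) K ⧸ I) ×
      (J →ₗ[MvPolynomial (Fin 2) K] MvPolynomial (Fin 2) K ⧸ J) :=
  (linearOnRestrict I LinearMap.id ∘ₗ Submodule.inclusion inf_le_left).prod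
    (linearOnRestrict J (quotProj h) ∘ₗ Submodule.inclusion inf_le_right)

theorem range_toTangent : range (toTangent h) = ker (psiMinusPhi K I J h) := by
  ext ⟨f₁, f₂⟩
  rw [LinearMap.mem_ker]
  have hker : psiMinusPhi K I J h (f₁, f₂) = 0 ↔
      ∀ r (hr : r ∈ I), quotProj h (f₁ ⟨r, hr⟩) = f₂ ⟨r, h hr⟩ := by
    rw [LinearMap.ext_iff, Subtype.forall]
    exact forall₂_congr fun r hr => sub_eq_zero
  rw [hker]
  constructor
  · rintro ⟨F, hF⟩ r hr
    obtain ⟨rfl, rfl⟩ := Prod.ext_iff.1 hF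
    rfl
  · intro hf
    obtain ⟨F₁, hF₁⟩ := LinearMap.exists_extend (p := I.restrictScalars K) (f₁.restrictScalars K)
    obtain ⟨F₂, hF₂⟩ := LinearMap.exists_extend (p := J.restrictScalars K) (f₂.restrictScalars K)
    have hF₁' (r) (hr : r ∈ I) : F₁ r = f₁ ⟨r, hr⟩ := LinearMap.congr_fun hF₁ ⟨r, hr⟩
    have hF₂' (r) (hr : r ∈ J) : F₂ r = f₂ ⟨r, hr⟩ := LinearMap.congr_fun hF₂ ⟨r, hr⟩
    have hsurj : range ((quotProj h).restrictScalars K) = ⊤ := by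
      refine LinearMap.range_eq_top.2 fun u => ?_
      obtain ⟨r, rfl⟩ := Submodule.Quotient.mk_surjective J u
      exact ⟨Submodule.Quotient.mk r, rfl⟩
    obtain ⟨σ, hσ⟩ := ((quotProj h).restrictScalars K).exists_rightInverse_of_surjective hsurj
    have hσ' (u) : quotProj h (σ u) = u := LinearMap.congr_fun hσ u
    set F := F₁ + σ ∘ₗ (F₂ - (quotProj h).restrictScalars K ∘ₗ F₁) with hF
    have hFJ (r) (hr : r ∈ J) : quotProj h (F r) = f₂ ⟨r, hr⟩ := by
      simp [hF, hσ', hF₂' r hr]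
    have hFI (r) (hr : r ∈ I) : F r = f₁ ⟨r, hr⟩ := by
      simp [hF, hF₂' r (h hr), hF₁' r hr, hf r hr]
    refine ⟨⟨F, fun i r hr => ?_, fun i r hr => ?_⟩, ?_⟩
    · rw [LinearMap.id_apply, LinearMap.id_apply, hFI r hr, hFI _ (I.mul_mem_left _ hr), ← map_smul]
      rfl
    · rw [hFJ r hr, hFJ _ (J.mul_mem_left _ hr), ← map_smul]
      rfl
    · exact Prod.ext (LinearMap.ext fun r => hFI r r.2) (LinearMap.ext fun r => hFJ r r.2)

variable (I) in
/-- Precomposition of endomorphisms of `R/I` with `R → R/I`. -/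
noncomputable def precompMk : End K (MvPolynomial (Fin 2) K ⧸ I) →ₗ[K]
    MvPolynomial (Fin 2) K →ₗ[K] MvPolynomial (Fin 2) K ⧸ I :=
  LinearMap.lcomp K _ (I.mkQ.restrictScalars K)

theorem precompMk_apply (φ : End K (MvPolynomial (Fin 2) K ⧸ I)) (r : MvPolynomial (Fin 2) K) :
    precompMk I φ r = φ (Submodule.Quotient.mk r) := rfl

theorem precompMk_injective : Function.Injective (precompMk I) := fun φ ψ hφ => by
  ext v
  obtain ⟨r, rfl⟩ := Submodule.Quotient.mk_surjective I v
  exact LinearMap.congr_fun hφ r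

theorem exists_precompMk {F : MvPolynomial (Fin 2) K →ₗ[K] MvPolynomial (Fin 2) K ⧸ I}
    (hF : ∀ r ∈ I, F r = 0) : ∃ φ, precompMk I φ = F := by
  obtain ⟨σ, hσ⟩ := (I.mkQ.restrictScalars K).exists_rightInverse_of_surjective
    (LinearMap.range_eq_top.2 I.mkQ_surjective)
  refine ⟨F ∘ₗ σ, LinearMap.ext fun r => ?_⟩
  refine sub_eq_zero.1 (?_ : F (σ (Submodule.Quotient.mk r)) - F r = 0)
  rw [← map_sub]
  refine hF _ ((Submodule.Quotient.eq I).1 ?_)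
  exact LinearMap.congr_fun hσ _

theorem map_subtype_ker_toTangent :
    (ker (toTangent h)).map (tangentLifts h).subtype =
      (parabolic ((ker (quotProj h)).restrictScalars K)).map (precompMk I) := by
  ext F
  constructor
  · rintro ⟨F, hF, rfl⟩
    obtain ⟨h₁, h₂⟩ := Prod.ext_iff.1 (LinearMap.mem_ker.1 hF)
    obtain ⟨φ, hφ⟩ := exists_precompMk (F := F.1) fun r hr => LinearMap.congr_fun h₁ ⟨r, hr⟩
    refine ⟨φ, fun v hv => ?_, hφ⟩
    obtain ⟨r, rfl⟩ := Submodule.Quotient.mk_surjective I v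
    rw [← precompMk_apply, hφ]
    exact LinearMap.congr_fun h₂ ⟨r, (mk_mem_ker_quotProj h).1 hv⟩
  · rintro ⟨φ, hφ, rfl⟩
    have hI (r) (hr : r ∈ I) : precompMk I φ r = 0 := by
      rw [precompMk_apply, (Submodule.Quotient.mk_eq_zero I).2 hr, map_zero]
    have hJ (r) (hr : r ∈ J) : quotProj h (precompMk I φ r) = 0 :=
      hφ _ ((mk_mem_ker_quotProj h).2 hr)
    refine ⟨⟨precompMk I φ, fun i r hr => ?_, fun i r hr => ?_⟩, ?_, rfl⟩
    · rw [hI r hr, hI _ (I.mul_mem_left _ hr)]; simp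
    · rw [hJ r hr, hJ _ (J.mul_mem_left _ hr)]; simp
    · exact Prod.ext (LinearMap.ext fun r => hI r r.2) (LinearMap.ext fun r => hJ r r.2)

variable (I) in
/-- The map `F ↦ (r ↦ Xᵢ F(r) - F(Xᵢ r))`. -/
noncomputable def commX (i : Fin 2) :
    (MvPolynomial (Fin 2) K →ₗ[K] MvPolynomial (Fin 2) K ⧸ I) →ₗ[K]
      MvPolynomial (Fin 2) K →ₗ[K] MvPolynomial (Fin 2) K ⧸ I :=
  LinearMap.llcomp K _ _ _ (Algebra.lsmul K K (MvPolynomial (Fin 2) K ⧸ I)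
    (X i : MvPolynomial (Fin 2) K)) -
    LinearMap.lcomp K _ (LinearMap.mulLeft K (X i))

theorem commX_apply (i : Fin 2) (F : MvPolynomial (Fin 2) K →ₗ[K] MvPolynomial (Fin 2) K ⧸ I)
    (r : MvPolynomial (Fin 2) K) :
    commX I i F r = (X i : MvPolynomial (Fin 2) K) • F r - F (X i * r) := rfl

/-- The pair of commutators of an element of `tangentLifts` with the two variables. -/
noncomputable def toCommutators : tangentLifts h →ₗ[K]
    (MvPolynomial (Fin 2) K →ₗ[K] MvPolynomial (Fin 2) K ⧸ I) ×
      (MvPolynomial (Fin 2) K →ₗ[K] MvPolynomial (Fin 2) K ⧸ I) :=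
  ((commX I 0).prod (commX I 1)) ∘ₗ (tangentLifts h).subtype

theorem exists_parabolic_of_mem_tangentLifts
    {F : MvPolynomial (Fin 2) K →ₗ[K] MvPolynomial (Fin 2) K ⧸ I} (hF : F ∈ tangentLifts h)
    (i : Fin 2) : ∃ A ∈ parabolic ((ker (quotProj h)).restrictScalars K),
      precompMk I A = commX I i F := by
  obtain ⟨A, hA⟩ := exists_precompMk (F := commX I i F) fun r hr => by
    rw [commX_apply, sub_eq_zero]
    exact (hF.1 i r hr).symm
  refine ⟨A, fun v hv => ?_, hA⟩
  obtain ⟨r, rfl⟩ := Submodule.Quotient.mk_surjective I v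
  rw [← precompMk_apply, hA, commX_apply]
  refine LinearMap.mem_ker.2 ?_
  rw [map_sub, map_smul, sub_eq_zero]
  exact (hF.2 i r ((mk_mem_ker_quotProj h).1 hv)).symm

theorem range_toCommutators :
    range (toCommutators h) = (ker (commutatorMap (ker (quotProj h)))).map
      ((precompMk I ∘ₗ Submodule.subtype _).prodMap (precompMk I ∘ₗ Submodule.subtype _)) := by
  ext ⟨G₀, G₁⟩
  constructor
  · rintro ⟨⟨F, hF⟩, hFG⟩
    obtain ⟨rfl, rfl⟩ := Prod.ext_iff.1 hFG
    obtain ⟨A, hAp, hA⟩ := exists_parabolic_of_mem_tangentLifts h hF 0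
    obtain ⟨B, hBp, hB⟩ := exists_parabolic_of_mem_tangentLifts h hF 1
    refine ⟨(⟨A, hAp⟩, ⟨B, hBp⟩), ?_, Prod.ext hA hB⟩
    refine LinearMap.mem_ker.2 (LinearMap.ext fun v => ?_)
    obtain ⟨r, rfl⟩ := Submodule.Quotient.mk_surjective I v
    have hA' (p : MvPolynomial (Fin 2) K) : A (Submodule.Quotient.mk p) =
        (X 0 : MvPolynomial (Fin 2) K) • F p - F (X 0 * p) := LinearMap.congr_fun hA p
    have hB' (p : MvPolynomial (Fin 2) K) : B (Submodule.Quotient.mk p) =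
        (X 1 : MvPolynomial (Fin 2) K) • F p - F (X 1 * p) := LinearMap.congr_fun hB p
    rw [commutatorMap_apply, LinearMap.sub_apply, adSMul_apply, adSMul_apply,
      ← Submodule.Quotient.mk_smul, ← Submodule.Quotient.mk_smul, hA', hA', hB', hB',
      smul_sub, smul_sub, smul_eq_mul, smul_eq_mul, mul_left_comm (X 1 : MvPolynomial (Fin 2) K),
      smul_comm (X 1 : MvPolynomial (Fin 2) K) (X 0 : MvPolynomial (Fin 2) K) (F r),
      LinearMap.zero_apply]
    abel
  · rintro ⟨⟨⟨A, hA⟩, ⟨B, hB⟩⟩, hAB, hG⟩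
    obtain ⟨rfl, rfl⟩ := Prod.ext_iff.1 hG
    have hAB' : adSMul _ (X 0) B = adSMul _ (X 1) A := sub_eq_zero.1 hAB
    obtain ⟨F, hF⟩ := exists_primitive ![A, B] (Submodule.Quotient.mk 1) hAB'
    have hF' (i : Fin 2) (r : MvPolynomial (Fin 2) K) :
        commX I i F r = ![A, B] i (Submodule.Quotient.mk r) := by
      rw [commX_apply, hF, ← Submodule.Quotient.mk_smul, smul_eq_mul, mul_one]
    have hp (i : Fin 2) : ![A, B] i ∈ parabolic ((ker (quotProj h)).restrictScalars K) := by
      fin_cases i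
      exacts [hA, hB]
    refine ⟨⟨F, fun i r hr => ?_, fun i r hr => ?_⟩, ?_⟩
    · have := hF' i r
      rw [(Submodule.Quotient.mk_eq_zero I).2 hr, map_zero, commX_apply, sub_eq_zero] at this
      exact this.symm
    · have := hp i _ ((mk_mem_ker_quotProj h).2 hr)
      rw [← hF', commX_apply] at this
      replace this := LinearMap.mem_ker.1 this
      rw [map_sub, map_smul, sub_eq_zero] at this
      exact this.symm
    · exact Prod.ext (LinearMap.ext (hF' 0)) (LinearMap.ext (hF' 1))

variable (I) in
/-- The `R`-linear maps `R → R/I`. -/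
noncomputable def smulMaps : (MvPolynomial (Fin 2) K ⧸ I) →ₗ[K]
    MvPolynomial (Fin 2) K →ₗ[K] MvPolynomial (Fin 2) K ⧸ I :=
  (Algebra.lsmul K K (MvPolynomial (Fin 2) K ⧸ I)).toLinearMap.flip

theorem smulMaps_apply (v : MvPolynomial (Fin 2) K ⧸ I) (r : MvPolynomial (Fin 2) K) :
    smulMaps I v r = r • v := rfl

theorem smulMaps_injective : Function.Injective (smulMaps I) := fun v w hvw => by
  simpa [smulMaps_apply] using LinearMap.congr_fun hvw 1

theorem map_subtype_ker_toCommutators :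
    (ker (toCommutators h)).map (tangentLifts h).subtype = range (smulMaps I) := by
  ext F
  constructor
  · rintro ⟨⟨F, hFT⟩, hF, rfl⟩
    obtain ⟨h₀, h₁⟩ := Prod.ext_iff.1 (LinearMap.mem_ker.1 hF)
    have hX : F ∈ linearOn ⊤ (LinearMap.id (M := MvPolynomial (Fin 2) K ⧸ I)) := by
      intro i r _
      fin_cases i
      exacts [(sub_eq_zero.1 (LinearMap.congr_fun h₀ r)).symm,
        (sub_eq_zero.1 (LinearMap.congr_fun h₁ r)).symm]
    refine ⟨F 1, LinearMap.ext fun r => ?_⟩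
    have := linearOn_map_mul hX r (r := 1) trivial
    simpa [smulMaps_apply] using this.symm
  · rintro ⟨v, rfl⟩
    refine ⟨⟨smulMaps I v, fun i r _ => ?_, fun i r _ => ?_⟩, ?_, rfl⟩
    · simp [smulMaps_apply, mul_smul]
    · simp [smulMaps_apply, mul_smul]
    · have hX (i : Fin 2) : commX I i (smulMaps I v) = 0 := LinearMap.ext fun r => by
        rw [commX_apply, smulMaps_apply, smulMaps_apply, mul_smul, sub_self, LinearMap.zero_apply]
      exact Prod.ext (hX 0) (hX 1)

theorem finite_tangentLifts_and_finrank [FiniteDimensional K (MvPolynomial (Fin 2) K ⧸ I)] :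
    Module.Finite K (tangentLifts h) ∧
      finrank K (ker (commutatorMap (ker (quotProj h)))) +
        finrank K (MvPolynomial (Fin 2) K ⧸ I) = finrank K (tangentLifts h) := by
  have := finite_ker_commutatorMap (ker (quotProj h))
  have hb : Function.Injective ((precompMk I ∘ₗ Submodule.subtype
      (parabolic ((ker (quotProj h)).restrictScalars K))).prodMap (precompMk I ∘ₗ
      Submodule.subtype (parabolic ((ker (quotProj h)).restrictScalars K)))) :=
    (precompMk_injective.comp Subtype.val_injective).prodMap
      (precompMk_injective.comp Subtype.val_injective)
  have := Submodule.finite_and_finrank_of_map_ker_eq (f := toCommutators h) smulMaps_injective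
    (map_subtype_ker_toCommutators h) hb (range_toCommutators h)
  exact this

theorem finrank_ker_psiMinusPhi_add [FiniteDimensional K (MvPolynomial (Fin 2) K ⧸ I)] :
    finrank K (ker (psiMinusPhi K I J h)) +
      finrank K (parabolic ((ker (quotProj h)).restrictScalars K)) =
        finrank K (tangentLifts h) := by
  have := (finite_tangentLifts_and_finrank h).1
  rw [← range_toTangent]
  exact Submodule.finrank_range_add_of_map_ker_eq precompMk_injective (map_subtype_ker_toTangent h)

/-- The tangent space of the nested Hilbert scheme of the plane at `(I, J)` has dimension `2n`
whenever `J/I` is cyclic. -/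
theorem finrank_ker_psiMinusPhi [FiniteDimensional K (MvPolynomial (Fin 2) K ⧸ I)]
    {g : MvPolynomial (Fin 2) K} (hgJ : g ∈ J) (hJ : J ≤ I ⊔ Ideal.span {g}) :
    finrank K (ker (psiMinusPhi K I J h)) = 2 * finrank K (MvPolynomial (Fin 2) K ⧸ I) := by
  have hZ := finrank_ker_commutatorMap (ker (quotProj h)) (e := Submodule.Quotient.mk 1)
    (g := Submodule.Quotient.mk g)
    (fun v => by
      obtain ⟨r, rfl⟩ := Submodule.Quotient.mk_surjective I v
      exact ⟨r, by rw [← Submodule.Quotient.mk_smul, smul_eq_mul, mul_one]⟩)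
    ((mk_mem_ker_quotProj h).2 hgJ)
    (fun v hv => by
      obtain ⟨r, rfl⟩ := Submodule.Quotient.mk_surjective I v
      obtain ⟨a, ha, b, hb, rfl⟩ := Submodule.mem_sup.1 (hJ ((mk_mem_ker_quotProj h).1 hv))
      obtain ⟨c, rfl⟩ := Ideal.mem_span_singleton'.1 hb
      refine ⟨c, ?_⟩
      rw [← Submodule.Quotient.mk_smul, smul_eq_mul, Submodule.Quotient.eq]
      simpa using ha)
  have e₁ := (finite_tangentLifts_and_finrank h).2
  have e₂ := finrank_ker_psiMinusPhi_add h
  omega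

end TangentSpace

section MonomialIdeals

open LinearMap Module

variable {K : Type*} [Field K]

theorem monomial_one_eq_mul (s : Fin 2 →₀ ℕ) :
    (monomial s 1 : MvPolynomial (Fin 2) K) = X 0 ^ s 0 * X 1 ^ s 1 := by
  rw [monomial_eq, C_1, one_mul, Finsupp.prod_fintype _ _ fun _ => pow_zero _, Fin.prod_univ_two]

theorem exists_generator_of_rectangle {I J : Ideal (MvPolynomial (Fin 2) K)}
    {S : Set (Fin 2 →₀ ℕ)} (hS : J = Ideal.span ((fun s => monomial s (1 : K)) '' S))
    {a₀ b₀ : ℕ} (h₀ : ∀ a b, (X 0 ^ a * X 1 ^ b : MvPolynomial (Fin 2) K) ∈ J →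
      (X 0 ^ a * X 1 ^ b : MvPolynomial (Fin 2) K) ∉ I →
        (X 0 ^ a₀ * X 1 ^ b₀ : MvPolynomial (Fin 2) K) ∈ J ∧ a₀ ≤ a ∧ b₀ ≤ b) :
    ∃ g ∈ J, J ≤ I ⊔ Ideal.span {g} := by
  have hSJ (s) (hs : s ∈ S) : (X 0 ^ s 0 * X 1 ^ s 1 : MvPolynomial (Fin 2) K) ∈ J := by
    rw [← monomial_one_eq_mul, hS]
    exact Ideal.subset_span ⟨s, hs, rfl⟩
  by_cases hex : ∃ s ∈ S, (X 0 ^ s 0 * X 1 ^ s 1 : MvPolynomial (Fin 2) K) ∉ I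
  · obtain ⟨s, hs, hsI⟩ := hex
    refine ⟨_, (h₀ _ _ (hSJ s hs) hsI).1, ?_⟩
    rw [hS, Ideal.span_le]
    rintro _ ⟨t, ht, rfl⟩
    simp only [monomial_one_eq_mul]
    by_cases htI : (X 0 ^ t 0 * X 1 ^ t 1 : MvPolynomial (Fin 2) K) ∈ I
    · exact Ideal.mem_sup_left htI
    · obtain ⟨-, ha, hb⟩ := h₀ _ _ (hSJ t ht) htI
      exact Ideal.mem_sup_right (Ideal.mem_span_singleton.2
        (mul_dvd_mul (pow_dvd_pow _ ha) (pow_dvd_pow _ hb)))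
  · push Not at hex
    refine ⟨0, J.zero_mem, ?_⟩
    rw [hS, Ideal.span_le]
    rintro _ ⟨t, ht, rfl⟩
    simp only [monomial_one_eq_mul]
    exact Ideal.mem_sup_left (hex t ht)

theorem exists_pow_mem_of_not_le_span_X {I : Ideal (MvPolynomial (Fin 2) K)}
    {S : Set (Fin 2 →₀ ℕ)} (hS : I = Ideal.span ((fun s => monomial s (1 : K)) '' S))
    {i j : Fin 2} (hij : i ≠ j) (hi : ¬ I ≤ Ideal.span {X i}) : ∃ n, X j ^ n ∈ I := by
  rw [hS, Ideal.span_le, Set.not_subset] at hi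
  obtain ⟨_, ⟨s, hs, rfl⟩, hsi⟩ := hi
  have hs₀ : s i = 0 := by
    by_contra h
    exact hsi (Ideal.mem_span_singleton.2 ((X_dvd_monomial).2 (Or.inr h)))
  refine ⟨s j, ?_⟩
  have hs' : s = Finsupp.single j (s j) := by
    ext l
    rcases eq_or_ne l j with rfl | hl
    · simp
    · obtain rfl : l = i := by omega
      rw [hs₀, Finsupp.single_eq_of_ne hl]
  rw [X_pow_eq_monomial, ← hs', hS]
  exact Ideal.subset_span ⟨s, hs, rfl⟩

theorem finite_quotient_of_pow_mem {σ : Type*} [Finite σ] {I : Ideal (MvPolynomial σ K)}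
    (h : ∀ i, ∃ n, X i ^ n ∈ I) : Module.Finite K (MvPolynomial σ K ⧸ I) := by
  have : Algebra.IsIntegral K (MvPolynomial σ K ⧸ I) := by
    refine ⟨fun v => ?_⟩
    obtain ⟨r, rfl⟩ := Ideal.Quotient.mk_surjective v
    induction r using MvPolynomial.induction_on with
    | C a => exact isIntegral_algebraMap (A := MvPolynomial σ K ⧸ I) (x := a)
    | add p q hp hq => rw [map_add]; exact hp.add hq
    | mul_X p i hp =>
      rw [map_mul]
      refine hp.mul ?_
      obtain ⟨n, hn⟩ := h i
      refine IsIntegral.of_pow n.succ_pos ?_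
      rw [← map_pow, Ideal.Quotient.eq_zero_iff_mem.2 (I.pow_mem_of_pow_mem hn n.le_succ)]
      exact isIntegral_zero
  exact Algebra.IsIntegral.finite

theorem exists_le_span_X_of_not_finite {I : Ideal (MvPolynomial (Fin 2) K)}
    {S : Set (Fin 2 →₀ ℕ)} (hS : I = Ideal.span ((fun s => monomial s (1 : K)) '' S))
    (hI : ¬ Module.Finite K (MvPolynomial (Fin 2) K ⧸ I)) : ∃ i, I ≤ Ideal.span {X i} := by
  contrapose! hI
  refine finite_quotient_of_pow_mem fun j => ?_
  obtain ⟨i, hij⟩ := exists_ne j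
  exact exists_pow_mem_of_not_le_span_X hS hij (hI i)

theorem X_dvd_of_forall_mul_mem {σ : Type*} {I : Ideal (MvPolynomial σ K)} (hI : I ≠ ⊥) {i : σ}
    {D : I → MvPolynomial σ K} (hD : ∀ z : I, D z * X i = (z : MvPolynomial σ K))
    {r : MvPolynomial σ K} (hr : ∀ z, r * D z ∈ I) : X i ∣ r := by
  by_contra hXr
  obtain ⟨z, hz, hz₀⟩ := Submodule.exists_mem_ne_zero_of_ne_bot hI
  have hpow (n : ℕ) : ∀ z : I, (X i : MvPolynomial σ K) ^ n ∣ z := by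
    induction n with
    | zero => simp
    | succ n ih =>
      intro z
      rw [← hD z, pow_succ]
      exact mul_dvd_mul_right ((X_prime).pow_dvd_of_dvd_mul_left n hXr (ih ⟨_, hr z⟩)) _
  obtain ⟨n, hn⟩ := FiniteMultiplicity.of_prime_left (X_prime (i := i)) hz₀
  exact hn (hpow (n + 1) ⟨z, hz⟩)

theorem eq_zero_of_X_dvd_aeval_X {σ : Type*} {i j : σ} (hij : i ≠ j) {q : Polynomial K}
    (hq : (X i : MvPolynomial σ K) ∣ Polynomial.aeval (X j : MvPolynomial σ K) q) : q = 0 := by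
  classical
  let ρ : MvPolynomial σ K →ₐ[K] Polynomial K :=
    MvPolynomial.aeval fun l => if l = i then 0 else Polynomial.X
  have h := map_dvd ρ hq
  rw [← Polynomial.aeval_algHom_apply] at h
  simpa [ρ, hij.symm, Polynomial.aeval_X_left_apply] using h

theorem finrank_ker_eq_zero_of_injective {E M Q : Type*} [AddCommGroup E] [Module K E]
    [AddCommGroup M] [Module K M] [AddCommGroup Q] [Module K Q] (hE : ¬ Module.Finite K E)
    {f : M →ₗ[K] Q} {T : E →ₗ[K] M} (hT : Function.Injective T) (hf : ∀ e, f (T e) = 0) :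
    finrank K (ker f) = 0 := by
  refine finrank_of_not_finite fun h => hE ?_
  exact Module.Finite.of_injective (T.codRestrict (ker f) hf)
    ((LinearMap.injective_codRestrict_iff hf).2 hT)

/-- If all elements of `J` are divisible by `X i`, the pairs `z ↦ q(X j) z / X i` are infinitely
many independent tangent vectors at `(I, J)`. -/
theorem finrank_ker_psiMinusPhi_of_le_span_X {σ : Type*} [Nontrivial σ]
    {I J : Ideal (MvPolynomial σ K)} (h : I ≤ J) (hI : I ≠ ⊥) {i : σ}
    (hJ : J ≤ Ideal.span {X i}) : finrank K (ker (psiMinusPhi K I J h)) = 0 := by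
  obtain ⟨j, hji⟩ := exists_ne i
  let D : J →ₗ[MvPolynomial σ K] MvPolynomial σ K :=
    (LinearEquiv.toSpanNonzeroSingleton _ _ (X i) (X_ne_zero i)).symm.toLinearMap ∘ₗ
      Submodule.inclusion hJ
  have hD (z : J) : D z * X i = (z : MvPolynomial σ K) :=
    LinearEquiv.toSpanNonzeroSingleton_symm_apply_smul _ _ _ (X_ne_zero i)
      (Submodule.inclusion hJ z)
  let f₁ : I →ₗ[MvPolynomial σ K] MvPolynomial σ K ⧸ I :=
    I.mkQ ∘ₗ D ∘ₗ Submodule.inclusion h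
  let f₂ : J →ₗ[MvPolynomial σ K] MvPolynomial σ K ⧸ J := J.mkQ ∘ₗ D
  let T : Polynomial K →ₗ[K] (I →ₗ[MvPolynomial σ K] MvPolynomial σ K ⧸ I) ×
      (J →ₗ[MvPolynomial σ K] MvPolynomial σ K ⧸ J) :=
    (LinearMap.toSpanSingleton (MvPolynomial σ K) _ (f₁, f₂)).restrictScalars K ∘ₗ
      (Polynomial.aeval (X j : MvPolynomial σ K)).toLinearMap
  refine finrank_ker_eq_zero_of_injective (T := T) Polynomial.not_finite
    ((injective_iff_map_eq_zero _).2 fun q hq => ?_) fun q => LinearMap.ext fun z => by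
      change psiMap K I J h (T q).1 z - phiMap K I J h (T q).2 z = 0
      exact sub_eq_zero.2 rfl
  have hq₁ (z : I) : Polynomial.aeval (X j : MvPolynomial σ K) q • f₁ z = 0 :=
    LinearMap.congr_fun (Prod.ext_iff.1 hq).1 z
  refine eq_zero_of_X_dvd_aeval_X hji.symm (X_dvd_of_forall_mul_mem hI
    (D := fun z => D (Submodule.inclusion h z)) (fun z => hD _) fun z => ?_)
  exact (Submodule.Quotient.mk_eq_zero I).1 (hq₁ z)

theorem le_span_X_of_le_span_X {I J : Ideal (MvPolynomial (Fin 2) K)} {S : Set (Fin 2 →₀ ℕ)}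
    (hS : J = Ideal.span ((fun s => monomial s (1 : K)) '' S)) {N : ℕ}
    (hN : ∀ a b, (X 0 ^ a * X 1 ^ b : MvPolynomial (Fin 2) K) ∈ J → N ≤ a + b →
      (X 0 ^ a * X 1 ^ b : MvPolynomial (Fin 2) K) ∈ I) {i : Fin 2}
    (hI : I ≤ Ideal.span {X i}) : J ≤ Ideal.span {X i} := by
  by_contra hJ
  obtain ⟨j, hji⟩ := exists_ne i
  obtain ⟨n, hn⟩ := exists_pow_mem_of_not_le_span_X hS hji.symm hJ
  have hmem : (X j ^ (n + N) : MvPolynomial (Fin 2) K) ∈ I := by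
    have hn' : (X j ^ (n + N) : MvPolynomial (Fin 2) K) ∈ J := by
      rw [pow_add]
      exact J.mul_mem_right _ hn
    fin_cases j
    · simpa using hN (n + N) 0 (by simpa using hn') (by omega)
    · simpa using hN 0 (n + N) (by simpa using hn') (by omega)
  have hdvd := X_prime.dvd_of_dvd_pow (Ideal.mem_span_singleton.1 (hI hmem))
  exact hji.symm (X_dvd_X.1 hdvd)

theorem eq_bot_of_finite_complement {J : Ideal (MvPolynomial (Fin 2) K)} {S : Set (Fin 2 →₀ ℕ)}
    (hS : J = Ideal.span ((fun s => monomial s (1 : K)) '' S)) {N : ℕ}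
    (hN : ∀ a b, (X 0 ^ a * X 1 ^ b : MvPolynomial (Fin 2) K) ∈ J → a + b < N) : J = ⊥ := by
  rw [hS, Ideal.span_eq_bot]
  rintro _ ⟨s, hs, rfl⟩
  have hsJ : (X 0 ^ s 0 * X 1 ^ s 1 : MvPolynomial (Fin 2) K) ∈ J := by
    rw [← monomial_one_eq_mul, hS]
    exact Ideal.subset_span ⟨s, hs, rfl⟩
  have := hN (N + s 0) (s 1) (by
    rw [pow_add, mul_assoc]
    exact J.mul_mem_left _ hsJ)
  omega

theorem finrank_ker_psiMinusPhi_bot {R : Type*} [CommRing R] [Algebra K R] {J : Ideal R}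
    (h : ⊥ ≤ J) (hJ : J = ⊥) : finrank K (ker (psiMinusPhi K ⊥ J h)) = 0 := by
  subst hJ
  exact finrank_zero_of_subsingleton

end MonomialIdeals

/-- If the monomials in `J` but not in `I` form a rectangle in exponent space, then the
tangent space `Ker(ψ - φ)` of the nested Hilbert scheme at `(I,J)` has dimension `2n`. -/
theorem nested_rectangle_smooth (n m : ℕ) (I J : Ideal (MvPolynomial (Fin 2) ℂ))
    (hIJ : I ≤ J) (hI : IsMonomialIdeal I) (hJ : IsMonomialIdeal J)
    (hn : Module.finrank ℂ (MvPolynomial (Fin 2) ℂ ⧸ I) = n)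
    (hm : Module.finrank ℂ (MvPolynomial (Fin 2) ℂ ⧸ J) = m)
    (hrect : ∃ a₀ b₀ w h : ℕ, ∀ a b : ℕ,
      ((X 0 ^ a * X 1 ^ b : MvPolynomial (Fin 2) ℂ) ∈ J ∧
        (X 0 ^ a * X 1 ^ b : MvPolynomial (Fin 2) ℂ) ∉ I) ↔
      (a₀ ≤ a ∧ a < a₀ + w ∧ b₀ ≤ b ∧ b < b₀ + h)) :
    Module.finrank ℂ ↥(LinearMap.ker (psiMinusPhi ℂ I J hIJ)) = 2 * n := by
  obtain ⟨S, hS⟩ := hI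
  obtain ⟨S', hS'⟩ := hJ
  obtain ⟨a₀, b₀, w, l, hrect⟩ := hrect
  subst hn
  by_cases hfin : Module.Finite ℂ (MvPolynomial (Fin 2) ℂ ⧸ I)
  · obtain ⟨g, hg, hJg⟩ := exists_generator_of_rectangle (I := I) hS' (a₀ := a₀) (b₀ := b₀)
      fun a b haJ haI => by
        have := (hrect a b).1 ⟨haJ, haI⟩
        exact ⟨((hrect a₀ b₀).2 (by omega)).1, by omega⟩
    exact finrank_ker_psiMinusPhi hIJ hg hJg
  · rw [Module.finrank_of_not_finite hfin, mul_zero]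
    have hN (a b : ℕ) (hab : (X 0 ^ a * X 1 ^ b : MvPolynomial (Fin 2) ℂ) ∈ J)
        (hle : a₀ + w + b₀ + l ≤ a + b) : (X 0 ^ a * X 1 ^ b : MvPolynomial (Fin 2) ℂ) ∈ I := by
      by_contra habI
      have := (hrect a b).1 ⟨hab, habI⟩
      omega
    rcases eq_or_ne I ⊥ with rfl | hbot
    · refine finrank_ker_psiMinusPhi_bot hIJ (eq_bot_of_finite_complement hS'
        (N := a₀ + w + b₀ + l) fun a b hab => ?_)
      by_contra hle
      have := hN a b hab (by omega)
      exact mul_ne_zero (pow_ne_zero _ (X_ne_zero _)) (pow_ne_zero _ (X_ne_zero _)) this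
    · obtain ⟨i, hi⟩ := exists_le_span_X_of_not_finite hS hfin
      exact finrank_ker_psiMinusPhi_of_le_span_X hIJ hbot
        (le_span_X_of_le_span_X hS' hN hi)
end
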